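/- Inhomogeneous trace estimate for the two-variable Schrödinger equation: for every exponent p > 1 sufficiently close to 1 there exist c > 0 and a constant C such that for every T ∈ (0,1], every Schwartz Λ₀, and every Schwartz F, the Duhamel solution Λ(t) = e^{it(Δ_x+Δ_y)}Λ₀ + i∫₀^t e^{i(t−s)(Δ_x+Δ_y)}F(s) ds of 𝐒Λ = F satisfies ‖Λ(t,x,x)‖_{L⁴([0,T];L²(dx))} ≤ C ( ‖Λ₀‖_{L²(ℝ²)} + T^c ‖F‖_{L²(dt)L^{p}(d(x−y))L²(d(x+y))} ). -/

import Mathlib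

open MeasureTheory Complex SchwartzMap
open scoped ENNReal NNReal Real

noncomputable section

/-- 1D Fourier transform with the convention `f̂ ξ = ∫ e^{-iξx} f x dx`. -/
def FT1 (f : ℝ → ℂ) (ξ : ℝ) : ℂ :=
  ∫ x : ℝ, Complex.exp (-(Complex.I) * (ξ : ℂ) * (x : ℂ)) * f x

/-- 1D inverse Fourier transform. -/
def IFT1 (g : ℝ → ℂ) (x : ℝ) : ℂ :=
  (2 * (Real.pi : ℂ))⁻¹ * ∫ ξ : ℝ, Complex.exp (Complex.I * (ξ : ℂ) * (x : ℂ)) * g ξ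

/-- 2D Fourier transform (curried kernels). -/
def FT2 (f : ℝ → ℝ → ℂ) (ξ η : ℝ) : ℂ :=
  ∫ x : ℝ, ∫ y : ℝ, Complex.exp (-(Complex.I) * ((ξ : ℂ) * x + (η : ℂ) * y)) * f x y

/-- 2D inverse Fourier transform. -/
def IFT2 (g : ℝ → ℝ → ℂ) (x y : ℝ) : ℂ :=
  ((2 * (Real.pi : ℂ)) ^ 2)⁻¹ *
    ∫ ξ : ℝ, ∫ η : ℝ, Complex.exp (Complex.I * ((ξ : ℂ) * x + (η : ℂ) * y)) * g ξ η

/-- Free propagator `e^{it(Δ_x − Δ_y)}`, Fourier multiplier `e^{it(η²−ξ²)}`. -/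
def freeGamma (Γ₀ : ℝ → ℝ → ℂ) (t x y : ℝ) : ℂ :=
  IFT2 (fun ξ η => Complex.exp (Complex.I * (t : ℂ) * ((η : ℂ) ^ 2 - (ξ : ℂ) ^ 2)) * FT2 Γ₀ ξ η) x y

/-- Free propagator `e^{it(Δ_x + Δ_y)}`, Fourier multiplier `e^{−it(ξ²+η²)}`. -/
def freeLambda (Λ₀ : ℝ → ℝ → ℂ) (t x y : ℝ) : ℂ :=
  IFT2 (fun ξ η => Complex.exp (-(Complex.I) * (t : ℂ) * ((ξ : ℂ) ^ 2 + (η : ℂ) ^ 2)) * FT2 Λ₀ ξ η) x y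

/-- `|∇_x|^s`, Fourier multiplier `|ξ|^s` in one variable. -/
def absDx (s : ℝ) (f : ℝ → ℂ) (x : ℝ) : ℂ :=
  IFT1 (fun ξ => ((|ξ| ^ s : ℝ) : ℂ) * FT1 f ξ) x

/-- `|∇_{x,y}|^s`, Fourier multiplier `(ξ²+η²)^{s/2}` on `ℝ²`. -/
def absDxy (s : ℝ) (f : ℝ → ℝ → ℂ) (x y : ℝ) : ℂ :=
  IFT2 (fun ξ η => (((ξ ^ 2 + η ^ 2) ^ (s / 2) : ℝ) : ℂ) * FT2 f ξ η) x y

/-- `|∇_{x+y}|^s`, Fourier multiplier `(|ξ+η|/2)^s` on `ℝ²`. -/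
def absDxpy (s : ℝ) (f : ℝ → ℝ → ℂ) (x y : ℝ) : ℂ :=
  IFT2 (fun ξ η => (((|ξ + η| / 2) ^ s : ℝ) : ℂ) * FT2 f ξ η) x y

/-- `⟨∇_x⟩^s`, Fourier multiplier `(1+ξ²)^{s/2}` in one variable. -/
def japDx (s : ℝ) (f : ℝ → ℂ) (x : ℝ) : ℂ :=
  IFT1 (fun ξ => (((1 + ξ ^ 2) ^ (s / 2) : ℝ) : ℂ) * FT1 f ξ) x

/-- `⟨∇_{x,y}⟩^s`, Fourier multiplier `(1+ξ²+η²)^{s/2}` on `ℝ²`. -/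
def japDxy (s : ℝ) (f : ℝ → ℝ → ℂ) (x y : ℝ) : ℂ :=
  IFT2 (fun ξ η => (((1 + ξ ^ 2 + η ^ 2) ^ (s / 2) : ℝ) : ℂ) * FT2 f ξ η) x y

/-- `L²` norm of a kernel on `ℝ²`. -/
def L2K (f : ℝ → ℝ → ℂ) : ℝ≥0∞ :=
  eLpNorm (fun p : ℝ × ℝ => f p.1 p.2) 2 volume

/-- `L²` norm on `ℝ`. -/
def L2F (f : ℝ → ℂ) : ℝ≥0∞ := eLpNorm f 2 volume

/-- Mixed norm `L^q(μ(dt)) L^r(dx)` for a function of `(t,x)`. -/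
def MixedN2 (μ : Measure ℝ) (q r : ℝ≥0∞) (u : ℝ → ℝ → ℂ) : ℝ≥0∞ :=
  eLpNorm (fun t => (eLpNorm (u t) r volume).toReal) q μ

/-- Mixed norm `L^q(μ(dt)) L^r(dx) L^s(dy)` for a function of `(t,x,y)`. -/
def MixedN3 (μ : Measure ℝ) (q r s : ℝ≥0∞) (u : ℝ → ℝ → ℝ → ℂ) : ℝ≥0∞ :=
  eLpNorm (fun t => (eLpNorm (fun x => (eLpNorm (u t x) s volume).toReal) r volume).toReal) q μ

/-- Spacetime Fourier transform on `ℝ_t × ℝ_x`. -/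
def FTtx (u : ℝ → ℝ → ℂ) (τ ξ : ℝ) : ℂ :=
  ∫ t : ℝ, ∫ x : ℝ, Complex.exp (-(Complex.I) * ((τ : ℂ) * t + (ξ : ℂ) * x)) * u t x

/-- Spacetime Fourier transform on `ℝ_t × ℝ²`. -/
def FTtxy (u : ℝ → ℝ → ℝ → ℂ) (τ ξ η : ℝ) : ℂ :=
  ∫ t : ℝ, ∫ x : ℝ, ∫ y : ℝ,
    Complex.exp (-(Complex.I) * ((τ : ℂ) * t + (ξ : ℂ) * x + (η : ℂ) * y)) * u t x y

/-- Bourgain space norm `X^b` associated to `𝐒 = (1/i)∂_t − Δ_x − Δ_y`. -/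
def XbNorm (b : ℝ) (u : ℝ → ℝ → ℝ → ℂ) : ℝ≥0∞ :=
  eLpNorm (fun p : ℝ × ℝ × ℝ =>
    (((1 + |p.1 + p.2.1 ^ 2 + p.2.2 ^ 2|) ^ b : ℝ) : ℂ) * FTtxy u p.1 p.2.1 p.2.2) 2 volume

/-- Duhamel solution of `𝐒_± Γ = F` with data `Γ₀`. -/
def duhamelGamma (Γ₀ : ℝ → ℝ → ℂ) (F : ℝ → ℝ → ℝ → ℂ) (t x y : ℝ) : ℂ :=
  freeGamma Γ₀ t x y + Complex.I * ∫ s in (0:ℝ)..t, freeGamma (F s) (t - s) x y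

/-- Duhamel solution of `𝐒 Λ = F` with data `Λ₀`. -/
def duhamelLambda (Λ₀ : ℝ → ℝ → ℂ) (F : ℝ → ℝ → ℝ → ℂ) (t x y : ℝ) : ℂ :=
  freeLambda Λ₀ t x y + Complex.I * ∫ s in (0:ℝ)..t, freeLambda (F s) (t - s) x y

section Inequalities

variable {α β : Type*} [MeasurableSpace α] [MeasurableSpace β] {μ : Measure α} {ν : Measure β}

/-- Cauchy–Schwarz for the lower Lebesgue integral. -/
theorem lintegral_mul_sq_le {f g : α → ℝ≥0∞} (hf : AEMeasurable f μ) (hg : AEMeasurable g μ) :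
    (∫⁻ x, f x * g x ∂μ) ^ 2 ≤ (∫⁻ x, f x ^ 2 ∂μ) * ∫⁻ x, g x ^ 2 ∂μ := by
  have h := ENNReal.lintegral_mul_le_Lp_mul_Lq μ Real.HolderConjugate.two_two hf hg
  simp only [Pi.mul_apply, ENNReal.rpow_two] at h
  refine (pow_le_pow_left' h 2).trans (le_of_eq ?_)
  rw [mul_pow, ← ENNReal.rpow_natCast, ← ENNReal.rpow_natCast, ← ENNReal.rpow_mul,
    ← ENNReal.rpow_mul]
  norm_num

theorem ENNReal.rpow_half_sq (a : ℝ≥0∞) : (a ^ (1 / 2 : ℝ)) ^ 2 = a := by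
  rw [← ENNReal.rpow_natCast, ← ENNReal.rpow_mul]; norm_num

theorem ENNReal.rpow_quarter_pow_four (a : ℝ≥0∞) : (a ^ (1 / 4 : ℝ)) ^ 4 = a := by
  rw [← ENNReal.rpow_natCast, ← ENNReal.rpow_mul]; norm_num

theorem ENNReal.sq_rpow_half (a : ℝ≥0∞) : (a ^ 2) ^ (1 / 2 : ℝ) = a := by
  rw [← ENNReal.rpow_natCast, ← ENNReal.rpow_mul]; norm_num

theorem ENNReal.pow_four_rpow_quarter (a : ℝ≥0∞) : (a ^ 4) ^ (1 / 4 : ℝ) = a := by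
  rw [← ENNReal.rpow_natCast, ← ENNReal.rpow_mul]; norm_num

theorem lintegral_mul_le_rpow_half {f g : α → ℝ≥0∞} (hf : AEMeasurable f μ)
    (hg : AEMeasurable g μ) :
    ∫⁻ x, f x * g x ∂μ ≤
      (∫⁻ x, f x ^ 2 ∂μ) ^ (1 / 2 : ℝ) * (∫⁻ x, g x ^ 2 ∂μ) ^ (1 / 2 : ℝ) := by
  have h := ENNReal.lintegral_mul_le_Lp_mul_Lq μ Real.HolderConjugate.two_two hf hg
  simpa only [Pi.mul_apply, ENNReal.rpow_two] using h

theorem lintegral_sq_eq_lintegral_prod [SFinite μ] {f : α → ℝ≥0∞} (hf : Measurable f) :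
    (∫⁻ x, f x ∂μ) ^ 2 = ∫⁻ z, f z.1 * f z.2 ∂(μ.prod μ) := by
  rw [lintegral_prod_mul hf.aemeasurable hf.aemeasurable, sq]

/-- Minkowski's integral inequality in `L²`. -/
theorem lintegral_lintegral_sq_le [SFinite μ] [SFinite ν] {a : α → β → ℝ≥0∞}
    (ha : Measurable (Function.uncurry a)) :
    ∫⁻ y, (∫⁻ x, a x y ∂μ) ^ 2 ∂ν ≤ (∫⁻ x, (∫⁻ y, a x y ^ 2 ∂ν) ^ (1 / 2 : ℝ) ∂μ) ^ 2 := by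
  have hx : ∀ x, Measurable (a x) := fun x => ha.of_uncurry_left
  have hy : ∀ y, Measurable (fun x => a x y) := fun y => ha.of_uncurry_right
  have hN : Measurable fun x => (∫⁻ y, a x y ^ 2 ∂ν) ^ (1 / 2 : ℝ) :=
    (Measurable.lintegral_prod_right' (f := fun z : α × β => a z.1 z.2 ^ 2)
      (ha.pow_const 2)).pow_const _
  calc ∫⁻ y, (∫⁻ x, a x y ∂μ) ^ 2 ∂ν
      = ∫⁻ y, ∫⁻ z, a z.1 y * a z.2 y ∂(μ.prod μ) ∂ν := by
        simp_rw [lintegral_sq_eq_lintegral_prod (hy _)]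
    _ = ∫⁻ z, ∫⁻ y, a z.1 y * a z.2 y ∂ν ∂(μ.prod μ) := by
        apply lintegral_lintegral_swap
        apply Measurable.aemeasurable
        exact (ha.comp ((measurable_fst.comp measurable_snd).prodMk measurable_fst)).mul
          (ha.comp ((measurable_snd.comp measurable_snd).prodMk measurable_fst))
    _ ≤ ∫⁻ z, (∫⁻ y, a z.1 y ^ 2 ∂ν) ^ (1 / 2 : ℝ) * (∫⁻ y, a z.2 y ^ 2 ∂ν) ^ (1 / 2 : ℝ)
          ∂(μ.prod μ) := by
        exact lintegral_mono fun z =>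
          lintegral_mul_le_rpow_half (hx _).aemeasurable (hx _).aemeasurable
    _ = _ := (lintegral_sq_eq_lintegral_prod hN).symm

/-- Minkowski's integral inequality in `L⁴`. -/
theorem lintegral_lintegral_pow_four_le [SFinite μ] [SFinite ν] {a : α → β → ℝ≥0∞}
    (ha : Measurable (Function.uncurry a)) :
    ∫⁻ y, (∫⁻ x, a x y ∂μ) ^ 4 ∂ν ≤ (∫⁻ x, (∫⁻ y, a x y ^ 4 ∂ν) ^ (1 / 4 : ℝ) ∂μ) ^ 4 := by
  have hx : ∀ x, Measurable (a x) := fun x => ha.of_uncurry_left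
  have hy : ∀ y, Measurable (fun x => a x y) := fun y => ha.of_uncurry_right
  have hN : Measurable fun x => (∫⁻ y, a x y ^ 4 ∂ν) ^ (1 / 4 : ℝ) :=
    (Measurable.lintegral_prod_right' (f := fun z : α × β => a z.1 z.2 ^ 4)
      (ha.pow_const 4)).pow_const _
  have hprod : Measurable (Function.uncurry fun (z : α × α) y => a z.1 y * a z.2 y) :=
    (ha.comp ((measurable_fst.comp measurable_fst).prodMk measurable_snd)).mul
      (ha.comp ((measurable_snd.comp measurable_fst).prodMk measurable_snd))
  calc ∫⁻ y, (∫⁻ x, a x y ∂μ) ^ 4 ∂ν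
      = ∫⁻ y, (∫⁻ z, a z.1 y * a z.2 y ∂(μ.prod μ)) ^ 2 ∂ν := by
        simp_rw [← lintegral_sq_eq_lintegral_prod (hy _), ← pow_mul]
    _ ≤ (∫⁻ z, (∫⁻ y, (a z.1 y * a z.2 y) ^ 2 ∂ν) ^ (1 / 2 : ℝ) ∂(μ.prod μ)) ^ 2 :=
        lintegral_lintegral_sq_le hprod
    _ ≤ (∫⁻ z, (∫⁻ y, a z.1 y ^ 4 ∂ν) ^ (1 / 4 : ℝ) * (∫⁻ y, a z.2 y ^ 4 ∂ν) ^ (1 / 4 : ℝ)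
          ∂(μ.prod μ)) ^ 2 := by
        refine pow_le_pow_left' (lintegral_mono fun z => ?_) 2
        have h := lintegral_mul_le_rpow_half (μ := ν) ((hx z.1).pow_const 2).aemeasurable
          ((hx z.2).pow_const 2).aemeasurable
        simp_rw [← mul_pow, ← pow_mul] at h
        refine (ENNReal.rpow_le_rpow h (by norm_num)).trans (le_of_eq ?_)
        rw [ENNReal.mul_rpow_of_nonneg _ _ (by norm_num), ← ENNReal.rpow_mul, ← ENNReal.rpow_mul]
        norm_num
    _ = _ := by
        rw [← lintegral_sq_eq_lintegral_prod hN, ← pow_mul]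

end Inequalities

section OscillatoryL2

/-- The Fourier transform of `τ ↦ exp (-ε τ²)`. -/
def gaussKernel (ε x : ℝ) : ℝ := √(π / ε) * Real.exp (-x ^ 2 / (4 * ε))

theorem gaussKernel_nonneg (ε x : ℝ) : 0 ≤ gaussKernel ε x := by
  unfold gaussKernel; positivity

theorem gaussKernel_sub_comm (ε x y : ℝ) : gaussKernel ε (x - y) = gaussKernel ε (y - x) := by
  unfold gaussKernel; rw [sub_sq_comm]

@[fun_prop]
theorem measurable_gaussKernel (ε : ℝ) : Measurable (gaussKernel ε) := by
  unfold gaussKernel; fun_prop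

theorem integral_cexp_mul_gaussian {ε : ℝ} (hε : 0 < ε) (x : ℝ) :
    ∫ τ : ℝ, cexp (I * τ * x) * cexp (-ε * τ ^ 2) = gaussKernel ε x := by
  have h := fourierIntegral_gaussian (b := ε) (by simpa using hε) x
  simp_rw [mul_right_comm I _ (x : ℂ)]
  rw [h, gaussKernel, Real.sqrt_eq_rpow]
  push_cast [Complex.ofReal_cpow (by positivity : (0 : ℝ) ≤ π / ε)]
  norm_num

theorem lintegral_gaussKernel {ε : ℝ} (hε : 0 < ε) :
    ∫⁻ x, ENNReal.ofReal (gaussKernel ε x) = ENNReal.ofReal (2 * π) := by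
  have h4 : (0 : ℝ) < 1 / (4 * ε) := by positivity
  have e : ∀ x, gaussKernel ε x = √(π / ε) * Real.exp (-(1 / (4 * ε)) * x ^ 2) := by
    intro x; unfold gaussKernel; congr 2; ring
  rw [← ofReal_integral_eq_lintegral_ofReal]
  · simp_rw [e]
    rw [integral_const_mul, integral_gaussian, ← Real.sqrt_mul (by positivity)]
    congr 1
    rw [Real.sqrt_eq_iff_mul_self_eq (by positivity) (by positivity)]
    field_simp; ring
  · rw [show gaussKernel ε = _ from funext e]
    exact (integrable_exp_neg_mul_sq h4).const_mul _
  · exact Filter.Eventually.of_forall fun x => gaussKernel_nonneg ε x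

theorem ENNReal.two_mul_mul_le_sq_add_sq (a b : ℝ≥0∞) : 2 * (a * b) ≤ a ^ 2 + b ^ 2 := by
  rcases le_total a b with h | h <;> obtain ⟨d, rfl⟩ := exists_add_of_le h
  · exact le_of_le_of_eq (le_self_add (b := d ^ 2)) (by ring)
  · exact le_of_le_of_eq (le_self_add (b := d ^ 2)) (by ring)

variable {Z : Type*} [MeasurableSpace Z] {μ : Measure Z} [SFinite μ]

theorem norm_cexp_I_mul_mul (x y : ℝ) : ‖cexp (I * x * y)‖ = 1 := by
  rw [mul_assoc, ← ofReal_mul, mul_comm, norm_exp_ofReal_mul_I]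

theorem lintegral_gaussian_mul_enorm_oscillatory_sq_le {φ : Z → ℝ} (hφ : Measurable φ)
    {G : Z → ℂ} (hG : Integrable G μ) (hGm : Measurable G) {M : ℝ≥0∞} {ε : ℝ} (hε : 0 < ε)
    (hM : ∀ z, ∫⁻ z', ENNReal.ofReal (gaussKernel ε (φ z' - φ z)) ∂μ ≤ M) :
    ∫⁻ τ : ℝ, ENNReal.ofReal (Real.exp (-ε * τ ^ 2)) * ‖∫ z, cexp (I * τ * φ z) * G z ∂μ‖ₑ ^ 2
      ≤ M * ∫⁻ z, ‖G z‖ₑ ^ 2 ∂μ := by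
  set J : ℝ → ℂ := fun τ => ∫ z, cexp (I * τ * φ z) * G z ∂μ
  set H : Z × Z → ℂ := fun w => G w.1 * star (G w.2) with hH
  have hHi : Integrable H (μ.prod μ) := hG.mul_prod (hG.mono
    (f := fun z => star (G z)) (by fun_prop) (Filter.Eventually.of_forall fun z => by simp))
  set Ψ : ℝ → Z × Z → ℂ := fun τ w =>
    cexp (-ε * τ ^ 2) * (cexp (I * τ * ((φ w.1 - φ w.2 : ℝ) : ℂ)) * H w) with hΨ
  have hexp : ∀ τ : ℝ, cexp (-ε * τ ^ 2) = (Real.exp (-ε * τ ^ 2) : ℂ) := by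
    intro τ; push_cast; rfl
  have hΨi : Integrable (Function.uncurry Ψ) (volume.prod (μ.prod μ)) := by
    have h0 : Integrable (fun x : ℝ × (Z × Z) => cexp (-ε * x.1 ^ 2) * H x.2)
        (volume.prod (μ.prod μ)) := by
      refine Integrable.mul_prod (f := fun τ : ℝ => cexp (-ε * τ ^ 2)) ?_ hHi
      simp_rw [hexp]
      exact (integrable_exp_neg_mul_sq hε).ofReal
    refine h0.mono ?_ ?_
    · apply Measurable.aestronglyMeasurable
      simp only [hΨ, hH, Function.uncurry_def]
      fun_prop
    · refine Filter.Eventually.of_forall fun x => le_of_eq ?_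
      simp only [hΨ, Function.uncurry_def, norm_mul, norm_cexp_I_mul_mul, one_mul]
  have hJ : ∀ τ : ℝ, ∫ w, Ψ τ w ∂(μ.prod μ) = ((Real.exp (-ε * τ ^ 2) * ‖J τ‖ ^ 2 : ℝ) : ℂ) := by
    intro τ
    simp only [hΨ]
    rw [integral_const_mul, hexp, ofReal_mul]
    congr 1
    have : ∀ w : Z × Z, cexp (I * τ * ((φ w.1 - φ w.2 : ℝ) : ℂ)) * H w =
        (cexp (I * τ * φ w.1) * G w.1) * star (cexp (I * τ * φ w.2) * G w.2) := by
      intro w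
      have : star (cexp (I * τ * φ w.2)) = cexp (-(I * τ * φ w.2)) := by
        rw [RCLike.star_def, ← Complex.exp_conj]; simp
      rw [star_mul', this, hH]
      rw [show I * τ * ((φ w.1 - φ w.2 : ℝ) : ℂ) = I * τ * φ w.1 + -(I * τ * φ w.2) by
        push_cast; ring, Complex.exp_add]
      ring
    simp_rw [this]
    rw [integral_prod_mul (fun z => cexp (I * τ * φ z) * G z)
      (fun z => star (cexp (I * τ * φ z) * G z))]
    have hs : ∫ z, star (cexp (I * τ * φ z) * G z) ∂μ = star (J τ) := by
      exact integral_conj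
    rw [hs, RCLike.star_def, Complex.mul_conj, Complex.normSq_eq_norm_sq]
  have hswap : ((∫ τ : ℝ, Real.exp (-ε * τ ^ 2) * ‖J τ‖ ^ 2 : ℝ) : ℂ) =
      ∫ w, (gaussKernel ε (φ w.1 - φ w.2) : ℂ) * H w ∂(μ.prod μ) := by
    rw [← integral_complex_ofReal]
    have := integral_integral_swap hΨi
    simp_rw [hJ] at this
    refine this.trans (integral_congr_ae (Filter.Eventually.of_forall fun w => ?_))
    simp only [hΨ]
    rw [← integral_cexp_mul_gaussian hε, ← integral_mul_const]
    congr 1; ext τ; ring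
  have hJint : Integrable fun τ : ℝ => Real.exp (-ε * τ ^ 2) * ‖J τ‖ ^ 2 := by
    have := hΨi.integral_prod_left
    simp only [Function.uncurry_def, hJ] at this
    simpa only [RCLike.re_to_complex, Complex.ofReal_re] using this.re
  have hk : Measurable fun w : Z × Z => ENNReal.ofReal (gaussKernel ε (φ w.1 - φ w.2)) := by
    fun_prop
  have hkc : Measurable fun w : Z × Z => (gaussKernel ε (φ w.1 - φ w.2) : ℂ) := by fun_prop
  have hHm : Measurable H := (hGm.comp measurable_fst).mul
    ((continuous_star.measurable.comp hGm).comp measurable_snd)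
  have hfst : ∫⁻ w, ENNReal.ofReal (gaussKernel ε (φ w.1 - φ w.2)) * ‖G w.1‖ₑ ^ 2 ∂(μ.prod μ)
      ≤ M * ∫⁻ z, ‖G z‖ₑ ^ 2 ∂μ := by
    rw [lintegral_prod _ (by fun_prop), ← lintegral_const_mul _ (by fun_prop)]
    refine lintegral_mono fun z => ?_
    simp only
    rw [lintegral_mul_const _ (by fun_prop)]
    gcongr
    simpa only [gaussKernel_sub_comm ε (φ z)] using hM z
  have hsnd : ∫⁻ w, ENNReal.ofReal (gaussKernel ε (φ w.1 - φ w.2)) * ‖G w.2‖ₑ ^ 2 ∂(μ.prod μ)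
      ≤ M * ∫⁻ z, ‖G z‖ₑ ^ 2 ∂μ := by
    rw [lintegral_prod_symm _ (by fun_prop), ← lintegral_const_mul _ (by fun_prop)]
    refine lintegral_mono fun z => ?_
    simp only
    rw [lintegral_mul_const _ (by fun_prop)]
    gcongr
    exact hM z
  have hbound : ∫⁻ w, ‖(gaussKernel ε (φ w.1 - φ w.2) : ℂ) * H w‖ₑ ∂(μ.prod μ)
      ≤ M * ∫⁻ z, ‖G z‖ₑ ^ 2 ∂μ := by
    have h2 : 2 * ∫⁻ w, ‖(gaussKernel ε (φ w.1 - φ w.2) : ℂ) * H w‖ₑ ∂(μ.prod μ)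
        ≤ 2 * (M * ∫⁻ z, ‖G z‖ₑ ^ 2 ∂μ) := by
      rw [two_mul (M * _), ← lintegral_const_mul _ (by
        exact (hkc.mul hHm).enorm)]
      refine le_trans ?_ (add_le_add hfst hsnd)
      rw [← lintegral_add_left (by fun_prop)]
      refine lintegral_mono fun w => ?_
      simp only [hH]
      rw [enorm_mul, enorm_mul, ← mul_add]
      have e1 : ‖(gaussKernel ε (φ w.1 - φ w.2) : ℂ)‖ₑ =
          ENNReal.ofReal (gaussKernel ε (φ w.1 - φ w.2)) := by
        rw [← ofReal_norm, Complex.norm_of_nonneg (gaussKernel_nonneg _ _)]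
      have e2 : ‖star (G w.2)‖ₑ = ‖G w.2‖ₑ := by
        rw [← ofReal_norm, norm_star, ofReal_norm]
      rw [e1, e2, mul_left_comm]
      gcongr
      exact ENNReal.two_mul_mul_le_sq_add_sq _ _
    exact (ENNReal.mul_le_mul_iff_right (by norm_num) (by norm_num)).1 h2
  calc ∫⁻ τ : ℝ, ENNReal.ofReal (Real.exp (-ε * τ ^ 2)) * ‖J τ‖ₑ ^ 2
      = ∫⁻ τ : ℝ, ENNReal.ofReal (Real.exp (-ε * τ ^ 2) * ‖J τ‖ ^ 2) := by
        refine lintegral_congr fun τ => ?_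
        rw [ENNReal.ofReal_mul (by positivity), ENNReal.ofReal_pow (norm_nonneg _),
          ofReal_norm]
    _ = ENNReal.ofReal (∫ τ : ℝ, Real.exp (-ε * τ ^ 2) * ‖J τ‖ ^ 2) :=
        (ofReal_integral_eq_lintegral_ofReal hJint
          (Filter.Eventually.of_forall fun τ => by positivity)).symm
    _ ≤ ‖∫ w, (gaussKernel ε (φ w.1 - φ w.2) : ℂ) * H w ∂(μ.prod μ)‖ₑ := by
        rw [← hswap, ← ofReal_norm, Complex.norm_real]
        exact ENNReal.ofReal_le_ofReal (le_abs_self _)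
    _ ≤ _ := (enorm_integral_le_lintegral_enorm _).trans hbound

/-- A Plancherel-type bound for oscillatory integrals with phase `φ`, by Schur's test. -/
theorem lintegral_enorm_oscillatory_sq_le {φ : Z → ℝ} (hφ : Measurable φ)
    {G : Z → ℂ} (hG : Integrable G μ) (hGm : Measurable G) {M : ℝ≥0∞}
    (hM : ∀ ε > 0, ∀ z, ∫⁻ z', ENNReal.ofReal (gaussKernel ε (φ z' - φ z)) ∂μ ≤ M) :
    ∫⁻ τ : ℝ, ‖∫ z, cexp (I * τ * φ z) * G z ∂μ‖ₑ ^ 2 ≤ M * ∫⁻ z, ‖G z‖ₑ ^ 2 ∂μ := by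
  set J : ℝ → ℂ := fun τ => ∫ z, cexp (I * τ * φ z) * G z ∂μ
  have hJm : Measurable J := by
    refine StronglyMeasurable.measurable ?_
    refine StronglyMeasurable.integral_prod_right (f := fun τ z => cexp (I * (τ : ℝ) * φ z) * G z)
      (Measurable.stronglyMeasurable ?_)
    simp only [Function.uncurry_def]
    fun_prop
  let ε : ℕ → ℝ := fun n => 1 / ((n : ℝ) + 1)
  have hε : ∀ n, 0 < ε n := fun n => Nat.one_div_pos_of_nat
  have hlim : ∀ τ : ℝ, Filter.Tendsto
      (fun n => ENNReal.ofReal (Real.exp (-ε n * τ ^ 2)) * ‖J τ‖ₑ ^ 2) Filter.atTop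
      (nhds (‖J τ‖ₑ ^ 2)) := by
    intro τ
    have h1 : Filter.Tendsto (fun n => Real.exp (-ε n * τ ^ 2)) Filter.atTop (nhds 1) := by
      have := (Real.continuous_exp.tendsto _).comp
        ((tendsto_one_div_add_atTop_nhds_zero_nat (𝕜 := ℝ)).neg.mul_const (τ ^ 2))
      simpa [ε, Function.comp_def] using this
    have h2 := ENNReal.Tendsto.mul_const (b := ‖J τ‖ₑ ^ 2) (ENNReal.tendsto_ofReal h1)
      (Or.inl (by simp))
    simpa using h2
  calc ∫⁻ τ : ℝ, ‖J τ‖ₑ ^ 2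
      = ∫⁻ τ : ℝ, Filter.liminf
          (fun n => ENNReal.ofReal (Real.exp (-ε n * τ ^ 2)) * ‖J τ‖ₑ ^ 2) Filter.atTop :=
        lintegral_congr fun τ => (hlim τ).liminf_eq.symm
    _ ≤ Filter.liminf (fun n => ∫⁻ τ : ℝ,
          ENNReal.ofReal (Real.exp (-ε n * τ ^ 2)) * ‖J τ‖ₑ ^ 2) Filter.atTop :=
        lintegral_liminf_le fun n => by fun_prop
    _ ≤ Filter.liminf (fun _ : ℕ => M * ∫⁻ z, ‖G z‖ₑ ^ 2 ∂μ) Filter.atTop :=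
        Filter.liminf_le_liminf (Filter.Eventually.of_forall fun n =>
          lintegral_gaussian_mul_enorm_oscillatory_sq_le hφ hG hGm (hε n) (hM _ (hε n)))
    _ = _ := Filter.liminf_const _

end OscillatoryL2

section OscTrace

/-- Plancherel's inequality on `ℝ`, in the normalization `∫ e^{iτw} m(w) dw`. -/
theorem lintegral_enorm_fourier_sq_le {m : ℝ → ℂ} (hm : Integrable m) (hmm : Measurable m) :
    ∫⁻ τ : ℝ, ‖∫ w : ℝ, cexp (I * τ * w) * m w‖ₑ ^ 2
      ≤ ENNReal.ofReal (2 * π) * ∫⁻ w, ‖m w‖ₑ ^ 2 := by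
  refine lintegral_enorm_oscillatory_sq_le (φ := fun w => w) measurable_id hm hmm
    fun ε hε z => ?_
  rw [lintegral_sub_right_eq_self (fun x => ENNReal.ofReal (gaussKernel ε x)) z,
    lintegral_gaussKernel hε]

theorem lintegral_two_mul_comp_sq_le (g : ℝ → ℝ≥0∞) :
    ∫⁻ r in Set.Ioi (0 : ℝ), ENNReal.ofReal (2 * r) * g (r ^ 2) ≤ ∫⁻ s, g s := by
  have h := lintegral_image_eq_lintegral_abs_deriv_mul (s := Set.Ioi (0 : ℝ))
    (f := fun r => r ^ 2) (f' := fun r => 2 * r) measurableSet_Ioi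
    (fun x _ => by simpa using (hasDerivAt_pow 2 x).hasDerivWithinAt)
    (fun x hx y hy hxy => (pow_left_inj₀ (le_of_lt hx) (le_of_lt hy) two_ne_zero).1 hxy) g
  have h2 : ∫⁻ r in Set.Ioi (0 : ℝ), ENNReal.ofReal (2 * r) * g (r ^ 2) =
      ∫⁻ r in Set.Ioi (0 : ℝ), ENNReal.ofReal |2 * r| * g (r ^ 2) :=
    setLIntegral_congr_fun measurableSet_Ioi fun r (hr : 0 < r) => by
      simp only [abs_of_pos (mul_pos two_pos hr)]
  rw [h2, ← h]
  exact setLIntegral_le_lintegral _ _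

theorem lintegral_radial_sq_le {g : ℝ → ℝ≥0∞} (hg : Measurable g) :
    ∫⁻ z : ℝ × ℝ, g (z.1 ^ 2 + z.2 ^ 2) ≤ ENNReal.ofReal π * ∫⁻ s, g s := by
  rw [← lintegral_comp_polarCoord_symm, polarCoord_target, Measure.volume_eq_prod,
    ← Measure.prod_restrict]
  have e : ∀ p : ℝ × ℝ, ENNReal.ofReal p.1 •
      g ((polarCoord.symm p).1 ^ 2 + (polarCoord.symm p).2 ^ 2) =
      ENNReal.ofReal p.1 * g (p.1 ^ 2) := by
    intro p
    simp only [polarCoord_symm_apply, smul_eq_mul]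
    congr 2
    linear_combination p.1 ^ 2 * Real.cos_sq_add_sin_sq p.2
  simp_rw [e]
  rw [lintegral_prod _ (by fun_prop)]
  simp only [lintegral_const, Measure.restrict_apply MeasurableSet.univ, Set.univ_inter,
    Real.volume_Ioo]
  calc ∫⁻ r in Set.Ioi (0 : ℝ), ENNReal.ofReal r * g (r ^ 2) * ENNReal.ofReal (π - -π)
      = ∫⁻ r in Set.Ioi (0 : ℝ), ENNReal.ofReal π * (ENNReal.ofReal (2 * r) * g (r ^ 2)) := by
        refine setLIntegral_congr_fun measurableSet_Ioi fun r (hr : 0 < r) => ?_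
        rw [show π - -π = π * 2 by ring, ENNReal.ofReal_mul Real.pi_nonneg,
          ENNReal.ofReal_mul zero_le_two]
        ring
    _ = ENNReal.ofReal π * ∫⁻ r in Set.Ioi (0 : ℝ), ENNReal.ofReal (2 * r) * g (r ^ 2) :=
        lintegral_const_mul _ (by fun_prop)
    _ ≤ _ := mul_le_mul_right (lintegral_two_mul_comp_sq_le g) _

theorem lintegral_enorm_quadratic_phase_mul_sq_le {g h : ℝ → ℂ} (hg : Integrable g)
    (hgm : Measurable g) (hh : Integrable h) (hhm : Measurable h) :
    ∫⁻ τ : ℝ, ‖∫ u : ℝ, cexp (I * τ * (u ^ 2 : ℝ)) * g u‖ₑ ^ 2 *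
        ‖∫ u : ℝ, cexp (I * τ * (u ^ 2 : ℝ)) * h u‖ₑ ^ 2
      ≤ ENNReal.ofReal (2 * π ^ 2) * ((∫⁻ u, ‖g u‖ₑ ^ 2) * ∫⁻ u, ‖h u‖ₑ ^ 2) := by
  have key := lintegral_enorm_oscillatory_sq_le (μ := (volume : Measure (ℝ × ℝ)))
    (φ := fun z => z.1 ^ 2 + z.2 ^ 2) (G := fun z => g z.1 * h z.2)
    (M := ENNReal.ofReal (2 * π ^ 2)) (by fun_prop) (hg.mul_prod hh) (by fun_prop)
    (fun ε hε z => by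
      refine (lintegral_radial_sq_le
        (g := fun s => ENNReal.ofReal (gaussKernel ε (s - (z.1 ^ 2 + z.2 ^ 2))))
        (by fun_prop)).trans (le_of_eq ?_)
      rw [lintegral_sub_right_eq_self (fun x => ENNReal.ofReal (gaussKernel ε x)),
        lintegral_gaussKernel hε, ← ENNReal.ofReal_mul Real.pi_nonneg]
      congr 1; ring)
  have e1 : ∫⁻ z : ℝ × ℝ, ‖g z.1 * h z.2‖ₑ ^ 2 =
      (∫⁻ u, ‖g u‖ₑ ^ 2) * ∫⁻ u, ‖h u‖ₑ ^ 2 := by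
    simp_rw [enorm_mul, mul_pow]
    exact lintegral_prod_mul (f := fun u => ‖g u‖ₑ ^ 2) (g := fun u => ‖h u‖ₑ ^ 2)
      (by fun_prop) (by fun_prop)
  rw [e1] at key
  refine le_trans (le_of_eq (lintegral_congr fun τ => ?_)) key
  rw [← mul_pow, ← enorm_mul, Measure.volume_eq_prod,
    ← integral_prod_mul (fun u : ℝ => cexp (I * τ * (u ^ 2 : ℝ)) * g u)
      (fun u : ℝ => cexp (I * τ * (u ^ 2 : ℝ)) * h u)]
  congr 3
  ext z
  rw [show I * τ * ((z.1 ^ 2 + z.2 ^ 2 : ℝ) : ℂ) =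
    I * τ * (z.1 ^ 2 : ℝ) + I * τ * (z.2 ^ 2 : ℝ) by push_cast; ring, Complex.exp_add]
  ring

theorem lintegral_inv_sq_mul_comp_inv_le (g : ℝ → ℝ≥0∞) (hg : Measurable g) :
    ∫⁻ t in Set.Ioi (0 : ℝ), ENNReal.ofReal (1 / t ^ 2) * g (1 / (8 * t)) ≤ 8 * ∫⁻ s, g s := by
  have h := lintegral_image_eq_lintegral_abs_deriv_mul (s := Set.Ioi (0 : ℝ))
    (f := fun t => 1 / (8 * t)) (f' := fun t => -(1 / (8 * t ^ 2))) measurableSet_Ioi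
    (fun x (hx : 0 < x) => by
      have := ((hasDerivAt_id x).const_mul 8).inv (by simpa using hx.ne')
      have h2 : HasDerivAt (fun t : ℝ => 1 / (8 * t)) (-(8 * 1) / (8 * x) ^ 2) x := by
        simp only [one_div]; exact this
      have e : -(1 / (8 * x ^ 2)) = -(8 * 1) / (8 * x) ^ 2 := by field_simp
      rw [e]; exact h2.hasDerivWithinAt)
    (fun x (hx : 0 < x) y (hy : 0 < y) hxy => by
      simp only at hxy
      field_simp at hxy
      linarith) g
  calc ∫⁻ t in Set.Ioi (0 : ℝ), ENNReal.ofReal (1 / t ^ 2) * g (1 / (8 * t))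
      = ∫⁻ t in Set.Ioi (0 : ℝ), 8 * (ENNReal.ofReal |-(1 / (8 * t ^ 2))| * g (1 / (8 * t))) := by
        refine setLIntegral_congr_fun measurableSet_Ioi fun t (ht : 0 < t) => ?_
        rw [abs_neg, abs_of_pos (by positivity), ← mul_assoc,
          show (8 : ℝ≥0∞) = ENNReal.ofReal 8 by simp, ← ENNReal.ofReal_mul (by norm_num)]
        congr 2
        field_simp
    _ = 8 * ∫⁻ t in Set.Ioi (0 : ℝ), ENNReal.ofReal |-(1 / (8 * t ^ 2))| * g (1 / (8 * t)) :=
        lintegral_const_mul _ (by fun_prop)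
    _ ≤ _ := by
        rw [← h]
        exact mul_le_mul_right (setLIntegral_le_lintegral _ _) _

/-- The oscillatory integral `∫ e^{iu²/(8t)} f(u,w) du` that carries the diagonal trace of the
free evolution of a kernel `f`, written in the variables `u = x - y` and `w = x + y`. -/
def oscTrace (f : ℝ × ℝ → ℂ) (t w : ℝ) : ℂ :=
  ∫ u : ℝ, cexp (I * (1 / (8 * t) : ℝ) * (u ^ 2 : ℝ)) * f (u, w)

theorem measurable_oscTrace_param {X : Type*} [MeasurableSpace X] {f : X → ℝ × ℝ → ℂ}
    (hf : Measurable (Function.uncurry f)) :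
    Measurable fun p : X × ℝ × ℝ => oscTrace (f p.1) p.2.1 p.2.2 := by
  refine StronglyMeasurable.measurable ?_
  refine StronglyMeasurable.integral_prod_right
    (f := fun (p : X × ℝ × ℝ) (u : ℝ) =>
      cexp (I * (1 / (8 * p.2.1) : ℝ) * (u ^ 2 : ℝ)) * f p.1 (u, p.2.2))
    (Measurable.stronglyMeasurable ?_)
  simp only [Function.uncurry_def]
  refine Measurable.mul (by fun_prop) ?_
  exact hf.comp (f := fun q : (X × ℝ × ℝ) × ℝ => (q.1.1, (q.2, q.1.2.2))) (by fun_prop)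

theorem measurable_oscTrace {f : ℝ × ℝ → ℂ} (hf : Measurable f) :
    Measurable fun p : ℝ × ℝ => oscTrace f p.1 p.2 :=
  (measurable_oscTrace_param (X := Unit) (f := fun _ => f) (hf.comp measurable_snd)).comp
    (f := fun p : ℝ × ℝ => ((), p)) (by fun_prop)

/-- Global-in-time `L⁴_t L²_w` bound for `t^{-1/2} oscTrace f`. -/
theorem lintegral_oscTrace_pow_four_le {f : ℝ × ℝ → ℂ} (hf : Measurable f)
    (hfi : ∀ w, Integrable fun u => f (u, w)) :
    ∫⁻ t in Set.Ioi (0 : ℝ), ENNReal.ofReal (1 / t ^ 2) * (∫⁻ w, ‖oscTrace f t w‖ₑ ^ 2) ^ 2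
      ≤ ENNReal.ofReal (16 * π ^ 2) * (∫⁻ w, ∫⁻ u, ‖f (u, w)‖ₑ ^ 2) ^ 2 := by
  let P : ℝ → ℝ → ℂ := fun τ w => ∫ u : ℝ, cexp (I * τ * (u ^ 2 : ℝ)) * f (u, w)
  have hP : Measurable fun p : ℝ × ℝ => P p.1 p.2 := by
    refine StronglyMeasurable.measurable ?_
    refine StronglyMeasurable.integral_prod_right
      (f := fun (p : ℝ × ℝ) (u : ℝ) => cexp (I * p.1 * (u ^ 2 : ℝ)) * f (u, p.2))
      (Measurable.stronglyMeasurable ?_)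
    simp only [Function.uncurry_def]
    fun_prop
  have hPw : ∀ τ, Measurable fun w => ‖P τ w‖ₑ ^ 2 := fun τ =>
    (hP.comp (f := fun w => (τ, w)) (by fun_prop)).enorm.pow_const 2
  have hfw : ∀ w, Measurable fun u => f (u, w) := fun w => by fun_prop
  have hN : Measurable fun w => ∫⁻ u, ‖f (u, w)‖ₑ ^ 2 :=
    Measurable.lintegral_prod_left' (f := fun z : ℝ × ℝ => ‖f z‖ₑ ^ 2) (by fun_prop)
  have hsub := lintegral_inv_sq_mul_comp_inv_le (fun τ => (∫⁻ w, ‖P τ w‖ₑ ^ 2) ^ 2)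
    ((Measurable.lintegral_prod_right' (f := fun z : ℝ × ℝ => ‖P z.1 z.2‖ₑ ^ 2)
      (by fun_prop)).pow_const 2)
  refine hsub.trans ?_
  rw [show 16 * π ^ 2 = 8 * (2 * π ^ 2) by ring, ENNReal.ofReal_mul (by norm_num), mul_assoc,
    show ENNReal.ofReal 8 = 8 by simp]
  gcongr
  calc ∫⁻ τ, (∫⁻ w, ‖P τ w‖ₑ ^ 2) ^ 2
      = ∫⁻ τ, ∫⁻ z : ℝ × ℝ, ‖P τ z.1‖ₑ ^ 2 * ‖P τ z.2‖ₑ ^ 2 := by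
        simp_rw [lintegral_sq_eq_lintegral_prod (hPw _), Measure.volume_eq_prod]
    _ = ∫⁻ z : ℝ × ℝ, ∫⁻ τ, ‖P τ z.1‖ₑ ^ 2 * ‖P τ z.2‖ₑ ^ 2 := by
        apply lintegral_lintegral_swap
        apply Measurable.aemeasurable
        exact ((hP.comp (f := fun q : ℝ × ℝ × ℝ => (q.1, q.2.1)) (by fun_prop)).enorm.pow_const
          2).mul ((hP.comp (f := fun q : ℝ × ℝ × ℝ => (q.1, q.2.2)) (by fun_prop)).enorm.pow_const
          2)
    _ ≤ ∫⁻ z : ℝ × ℝ, ENNReal.ofReal (2 * π ^ 2) *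
          ((∫⁻ u, ‖f (u, z.1)‖ₑ ^ 2) * ∫⁻ u, ‖f (u, z.2)‖ₑ ^ 2) :=
        lintegral_mono fun z => lintegral_enorm_quadratic_phase_mul_sq_le (hfi _) (hfw _)
          (hfi _) (hfw _)
    _ = _ := by
        rw [lintegral_const_mul _ (by fun_prop), lintegral_sq_eq_lintegral_prod hN,
          Measure.volume_eq_prod]

end OscTrace

section Kernel

theorem norm_cexp_neg_I_mul (a b : ℝ) : ‖cexp (-I * ((a : ℂ) + b))‖ = 1 := by
  rw [show -I * ((a : ℂ) + b) = ((-(a + b) : ℝ) : ℂ) * I by push_cast; ring,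
    norm_exp_ofReal_mul_I]

theorem FT2_eq_integral_prod {f : ℝ × ℝ → ℂ} (hf : Integrable f) (ξ η : ℝ) :
    FT2 (fun a b => f (a, b)) ξ η =
      ∫ z : ℝ × ℝ, cexp (-I * ((ξ : ℂ) * z.1 + (η : ℂ) * z.2)) * f z := by
  rw [Measure.volume_eq_prod, integral_prod, FT2]
  refine hf.mono ?_ (Filter.Eventually.of_forall fun z => ?_)
  · exact (Continuous.aestronglyMeasurable (by fun_prop)).mul hf.aestronglyMeasurable
  · have := norm_cexp_neg_I_mul (ξ * z.1) (η * z.2)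
    push_cast at this
    rw [norm_mul, this, one_mul]

open FourierTransform in
theorem integrable_FT2 (f : 𝓢(ℝ × ℝ, ℂ)) :
    Integrable fun ζ : ℝ × ℝ => FT2 (fun a b => f (a, b)) ζ.1 ζ.2 := by
  let e := WithLp.prodContinuousLinearEquiv 2 ℝ ℝ ℝ
  let g : 𝓢(WithLp 2 (ℝ × ℝ), ℂ) := compCLMOfContinuousLinearEquiv ℂ e f
  have h1 : Integrable fun z : ℝ × ℝ => 𝓕 g (WithLp.toLp 2 z) :=
    (WithLp.volume_preserving_toLp (U := ℝ) (V := ℝ)).integrable_comp_of_integrable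
      (𝓕 g).integrable
  have h2 := h1.comp_smul (R := 1 / (2 * π)) (by positivity)
  refine h2.congr (Filter.Eventually.of_forall fun ζ => ?_)
  simp only
  rw [FT2_eq_integral_prod f.integrable, SchwartzMap.fourier_coe, Real.fourier_eq']
  rw [← (WithLp.volume_preserving_toLp (U := ℝ) (V := ℝ)).integral_comp
    (MeasurableEquiv.toLp 2 (ℝ × ℝ)).measurableEmbedding]
  refine integral_congr_ae (Filter.Eventually.of_forall fun z => ?_)
  simp only [smul_eq_mul, WithLp.prod_inner_apply]
  refine congrArg₂ (· * ·) (congrArg cexp ?_) rfl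
  simp
  field_simp

theorem norm_cexp_neg_mul_le_one {b : ℂ} (hb : 0 ≤ b.re) {q : ℝ} (hq : 0 ≤ q) :
    ‖cexp (-b * q)‖ ≤ 1 := by
  rw [Complex.norm_exp]
  refine Real.exp_le_one_iff.2 ?_
  simp only [neg_mul, neg_re, re_mul_ofReal]
  exact neg_nonpos.2 (mul_nonneg hb hq)

theorem integral_prod_gaussian_mul_cexp {b : ℂ} (hb : 0 < b.re) (p q : ℝ) :
    ∫ ζ : ℝ × ℝ, cexp (-b * ((ζ.1 ^ 2 + ζ.2 ^ 2 : ℝ) : ℂ)) *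
        cexp (I * ((ζ.1 : ℂ) * p + (ζ.2 : ℂ) * q)) =
      π / b * cexp (-(1 / (4 * b)) * ((p ^ 2 + q ^ 2 : ℝ) : ℂ)) := by
  have hb0 : b ≠ 0 := by rintro rfl; simp at hb
  have e : ∀ ζ : ℝ × ℝ, cexp (-b * ((ζ.1 ^ 2 + ζ.2 ^ 2 : ℝ) : ℂ)) *
        cexp (I * ((ζ.1 : ℂ) * p + (ζ.2 : ℂ) * q)) =
      (cexp (I * p * ζ.1) * cexp (-b * (ζ.1 : ℂ) ^ 2)) *
        (cexp (I * q * ζ.2) * cexp (-b * (ζ.2 : ℂ) ^ 2)) := by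
    intro ζ
    simp only [← Complex.exp_add]
    congr 1
    push_cast; ring
  simp_rw [e]
  rw [Measure.volume_eq_prod, integral_prod_mul
    (fun ξ : ℝ => cexp (I * p * ξ) * cexp (-b * (ξ : ℂ) ^ 2))
    (fun ξ : ℝ => cexp (I * q * ξ) * cexp (-b * (ξ : ℂ) ^ 2)),
    fourierIntegral_gaussian hb, fourierIntegral_gaussian hb]
  have hs : (π / b) ^ (1 / 2 : ℂ) * (π / b) ^ (1 / 2 : ℂ) = π / b := by
    rw [← Complex.cpow_add _ _ (div_ne_zero (by exact_mod_cast Real.pi_ne_zero) hb0)]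
    norm_num
  rw [mul_mul_mul_comm, hs, ← Complex.exp_add]
  congr 2
  push_cast; field_simp; ring

theorem integrable_cexp_neg_mul_sq_add_sq {b : ℂ} (hb : 0 < b.re) :
    Integrable fun ζ : ℝ × ℝ => cexp (-b * ((ζ.1 ^ 2 + ζ.2 ^ 2 : ℝ) : ℂ)) := by
  have h := (integrable_cexp_neg_mul_sq hb).mul_prod (integrable_cexp_neg_mul_sq hb)
  refine h.congr (Filter.Eventually.of_forall fun ζ => ?_)
  simp only [← Complex.exp_add]
  congr 1
  push_cast; ring

theorem integral_gaussian_mul_FT2 {f : ℝ × ℝ → ℂ} (hf : Integrable f) {b : ℂ} (hb : 0 < b.re)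
    (x : ℝ) :
    ∫ ζ : ℝ × ℝ, cexp (-b * ((ζ.1 ^ 2 + ζ.2 ^ 2 : ℝ) : ℂ)) *
        (cexp (I * ((ζ.1 : ℂ) * x + (ζ.2 : ℂ) * x)) * FT2 (fun a b => f (a, b)) ζ.1 ζ.2) =
      π / b * ∫ z : ℝ × ℝ,
        cexp (-(1 / (4 * b)) * (((x - z.1) ^ 2 + (x - z.2) ^ 2 : ℝ) : ℂ)) * f z := by
  let K : ℝ × ℝ → ℝ × ℝ → ℂ := fun ζ z =>
    cexp (I * ((ζ.1 : ℂ) * ((x - z.1 : ℝ) : ℂ) + (ζ.2 : ℂ) * ((x - z.2 : ℝ) : ℂ)))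
  have hK : ∀ ζ z, ‖K ζ z‖ = 1 := by
    intro ζ z
    simp only [K]
    rw [show I * ((ζ.1 : ℂ) * ((x - z.1 : ℝ) : ℂ) + (ζ.2 : ℂ) * ((x - z.2 : ℝ) : ℂ)) =
      ((ζ.1 * (x - z.1) + ζ.2 * (x - z.2) : ℝ) : ℂ) * I by push_cast; ring,
      norm_exp_ofReal_mul_I]
  have hKc : Continuous fun p : (ℝ × ℝ) × (ℝ × ℝ) => K p.1 p.2 := by
    simp only [K]; fun_prop
  have e1 : ∀ ζ : ℝ × ℝ, cexp (-b * ((ζ.1 ^ 2 + ζ.2 ^ 2 : ℝ) : ℂ)) *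
        (cexp (I * ((ζ.1 : ℂ) * x + (ζ.2 : ℂ) * x)) * FT2 (fun a b => f (a, b)) ζ.1 ζ.2) =
      ∫ z : ℝ × ℝ, K ζ z * (cexp (-b * ((ζ.1 ^ 2 + ζ.2 ^ 2 : ℝ) : ℂ)) * f z) := by
    intro ζ
    rw [FT2_eq_integral_prod hf, ← integral_const_mul, ← integral_const_mul]
    refine integral_congr_ae (Filter.Eventually.of_forall fun z => ?_)
    simp only [K]
    rw [show I * ((ζ.1 : ℂ) * ((x - z.1 : ℝ) : ℂ) + (ζ.2 : ℂ) * ((x - z.2 : ℝ) : ℂ)) =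
      I * ((ζ.1 : ℂ) * x + (ζ.2 : ℂ) * x) + -I * ((ζ.1 : ℂ) * z.1 + (ζ.2 : ℂ) * z.2) by
      push_cast; ring, Complex.exp_add]
    ring
  have hi : Integrable (Function.uncurry fun ζ z : ℝ × ℝ =>
      K ζ z * (cexp (-b * ((ζ.1 ^ 2 + ζ.2 ^ 2 : ℝ) : ℂ)) * f z)) (volume.prod volume) := by
    have h0 := (integrable_cexp_neg_mul_sq_add_sq hb).mul_prod hf
    refine h0.mono (hKc.aestronglyMeasurable.mul h0.aestronglyMeasurable)
      (Filter.Eventually.of_forall fun p => ?_)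
    simp only [Function.uncurry_def, norm_mul, hK, one_mul, le_refl]
  simp_rw [e1]
  rw [integral_integral_swap hi, ← integral_const_mul]
  refine integral_congr_ae (Filter.Eventually.of_forall fun z => ?_)
  simp only
  rw [← mul_assoc, ← integral_prod_gaussian_mul_cexp hb, ← integral_mul_const]
  refine integral_congr_ae (Filter.Eventually.of_forall fun ζ => ?_)
  simp only [K]
  ring

/-- The Schrödinger kernel representation of the diagonal trace of the free evolution. -/
theorem freeLambda_diag_eq (f : 𝓢(ℝ × ℝ, ℂ)) {t : ℝ} (ht : 0 < t) (x : ℝ) :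
    freeLambda (fun a b => f (a, b)) t x x =
      ((2 * (π : ℂ)) ^ 2)⁻¹ * (π / (I * t) * ∫ z : ℝ × ℝ,
        cexp (-(1 / (4 * (I * t))) * (((x - z.1) ^ 2 + (x - z.2) ^ 2 : ℝ) : ℂ)) * f z) := by
  let h : ℝ × ℝ → ℂ := fun ζ =>
    cexp (I * ((ζ.1 : ℂ) * x + (ζ.2 : ℂ) * x)) * FT2 (fun a b => f (a, b)) ζ.1 ζ.2
  have hh : Integrable h := by
    refine (integrable_FT2 f).mono ((Continuous.aestronglyMeasurable (by fun_prop)).mul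
      (integrable_FT2 f).aestronglyMeasurable) (Filter.Eventually.of_forall fun ζ => ?_)
    simp only [h, norm_mul]
    rw [show I * ((ζ.1 : ℂ) * x + (ζ.2 : ℂ) * x) = ((ζ.1 * x + ζ.2 * x : ℝ) : ℂ) * I by
      push_cast; ring, norm_exp_ofReal_mul_I, one_mul]
  have hmeas : ∀ b : ℂ, AEStronglyMeasurable
      (fun ζ : ℝ × ℝ => cexp (-b * ((ζ.1 ^ 2 + ζ.2 ^ 2 : ℝ) : ℂ)) * h ζ) := fun b =>
    (Continuous.aestronglyMeasurable (by fun_prop)).mul hh.aestronglyMeasurable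
  have hbd : ∀ b : ℂ, 0 ≤ b.re → ∀ ζ : ℝ × ℝ,
      ‖cexp (-b * ((ζ.1 ^ 2 + ζ.2 ^ 2 : ℝ) : ℂ)) * h ζ‖ ≤ ‖h ζ‖ := by
    intro b hb ζ
    rw [norm_mul]
    exact mul_le_of_le_one_left (norm_nonneg _) (norm_cexp_neg_mul_le_one hb (by positivity))
  have hfree : freeLambda (fun a b => f (a, b)) t x x = ((2 * (π : ℂ)) ^ 2)⁻¹ *
      ∫ ζ : ℝ × ℝ, cexp (-(I * t) * ((ζ.1 ^ 2 + ζ.2 ^ 2 : ℝ) : ℂ)) * h ζ := by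
    rw [freeLambda, IFT2, Measure.volume_eq_prod, integral_prod]
    · congr 2; ext ξ; congr 1; ext η
      simp only [h]
      rw [mul_left_comm]
      congr 2
      push_cast; ring
    · exact hh.mono (hmeas _) (Filter.Eventually.of_forall (hbd _ (by simp)))
  let b : ℕ → ℂ := fun n => ((1 / ((n : ℝ) + 1) : ℝ) : ℂ) + I * t
  have hbre : ∀ n, 0 < (b n).re := by
    intro n
    simp only [b, add_re, ofReal_re, mul_re, I_re, I_im, ofReal_im]
    have : (0 : ℝ) < 1 / ((n : ℝ) + 1) := Nat.one_div_pos_of_nat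
    linarith
  have hblim : Filter.Tendsto b Filter.atTop (nhds (I * t)) := by
    have h1 := (Complex.continuous_ofReal.tendsto _).comp
      (tendsto_one_div_add_atTop_nhds_zero_nat (𝕜 := ℝ))
    have h2 := h1.add_const (I * (t : ℂ))
    simpa only [b, Function.comp_def, ofReal_zero, zero_add] using h2
  have hIt : I * (t : ℂ) ≠ 0 := mul_ne_zero I_ne_zero (by exact_mod_cast ht.ne')
  have hinv : Filter.Tendsto (fun n => 1 / (4 * b n)) Filter.atTop
      (nhds (1 / (4 * (I * t)))) :=
    tendsto_const_nhds.div (hblim.const_mul 4) (mul_ne_zero (by norm_num) hIt)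
  have hinvre : ∀ n, 0 ≤ (1 / (4 * b n)).re := by
    intro n
    rw [one_div, Complex.inv_re]
    refine div_nonneg ?_ (normSq_nonneg _)
    simpa using (hbre n).le
  have lim1 : Filter.Tendsto
      (fun n => ∫ ζ : ℝ × ℝ, cexp (-b n * ((ζ.1 ^ 2 + ζ.2 ^ 2 : ℝ) : ℂ)) * h ζ) Filter.atTop
      (nhds (∫ ζ : ℝ × ℝ, cexp (-(I * t) * ((ζ.1 ^ 2 + ζ.2 ^ 2 : ℝ) : ℂ)) * h ζ)) := by
    refine tendsto_integral_of_dominated_convergence (fun ζ => ‖h ζ‖) (fun n => hmeas _) hh.norm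
      (fun n => Filter.Eventually.of_forall (hbd _ (hbre n).le))
      (Filter.Eventually.of_forall fun ζ => ?_)
    exact ((Complex.continuous_exp.tendsto _).comp (hblim.neg.mul_const _)).mul_const _
  have lim2 : Filter.Tendsto
      (fun n => π / b n * ∫ z : ℝ × ℝ,
        cexp (-(1 / (4 * b n)) * (((x - z.1) ^ 2 + (x - z.2) ^ 2 : ℝ) : ℂ)) * f z) Filter.atTop
      (nhds (π / (I * t) * ∫ z : ℝ × ℝ,
        cexp (-(1 / (4 * (I * t))) * (((x - z.1) ^ 2 + (x - z.2) ^ 2 : ℝ) : ℂ)) * f z)) := by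
    refine (tendsto_const_nhds.div hblim hIt).mul ?_
    refine tendsto_integral_of_dominated_convergence (fun z => ‖f z‖) (fun n => ?_)
      f.integrable.norm (fun n => Filter.Eventually.of_forall fun z => ?_)
      (Filter.Eventually.of_forall fun z => ?_)
    · exact (Continuous.aestronglyMeasurable (by fun_prop)).mul
        f.integrable.aestronglyMeasurable
    · rw [norm_mul]
      exact mul_le_of_le_one_left (norm_nonneg _)
        (norm_cexp_neg_mul_le_one (hinvre n) (by positivity))
    · exact ((Complex.continuous_exp.tendsto _).comp (hinv.neg.mul_const _)).mul_const _
  have heq : ∀ n, ∫ ζ : ℝ × ℝ, cexp (-b n * ((ζ.1 ^ 2 + ζ.2 ^ 2 : ℝ) : ℂ)) * h ζ =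
      π / b n * ∫ z : ℝ × ℝ,
        cexp (-(1 / (4 * b n)) * (((x - z.1) ^ 2 + (x - z.2) ^ 2 : ℝ) : ℂ)) * f z :=
    fun n => integral_gaussian_mul_FT2 f.integrable (hbre n) x
  simp_rw [heq] at lim1
  rw [hfree, tendsto_nhds_unique lim1 lim2]

end Kernel

section Rotation

/-- The change of variables from `(u, w) = (x - y, x + y)` to `(x, y)`. -/
def diffSum : ℝ × ℝ →ₗ[ℝ] ℝ × ℝ :=
  Matrix.toLin (Module.Basis.finTwoProd ℝ) (Module.Basis.finTwoProd ℝ)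
    !![1 / 2, 1 / 2; -(1 / 2), 1 / 2]

theorem diffSum_apply (p : ℝ × ℝ) : diffSum p = ((p.2 + p.1) / 2, (p.2 - p.1) / 2) := by
  rw [diffSum, Matrix.toLin_finTwoProd_apply]
  ext <;> simp <;> ring

theorem measurable_diffSum : Measurable diffSum := by
  rw [show (diffSum : ℝ × ℝ → ℝ × ℝ) = _ from funext diffSum_apply]; fun_prop

theorem map_diffSum_volume : Measure.map diffSum volume = (2 : ℝ≥0∞) • volume := by
  have hdet : LinearMap.det diffSum = 1 / 2 := by
    rw [diffSum, LinearMap.det_toLin, Matrix.det_fin_two_of]; norm_num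
  rw [Measure.map_linearMap_addHaar_eq_smul_addHaar _ (by rw [hdet]; norm_num), hdet]
  norm_num

theorem lintegral_comp_diffSum {g : ℝ × ℝ → ℝ≥0∞} (hg : Measurable g) :
    ∫⁻ p, g (diffSum p) = 2 * ∫⁻ z, g z := by
  rw [← lintegral_map hg measurable_diffSum, map_diffSum_volume, lintegral_smul_measure,
    smul_eq_mul]

theorem integral_comp_diffSum {g : ℝ × ℝ → ℂ} (hg : StronglyMeasurable g) :
    ∫ p, g (diffSum p) = 2 * ∫ z, g z := by
  rw [← integral_map measurable_diffSum.aemeasurable hg.aestronglyMeasurable,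
    map_diffSum_volume, integral_smul_measure]
  simp

theorem integrable_comp_diffSum {g : ℝ × ℝ → ℂ} (hg : Integrable g) (hgm : Measurable g) :
    Integrable fun p => g (diffSum p) := by
  refine (integrable_map_measure hgm.aestronglyMeasurable measurable_diffSum.aemeasurable).1 ?_
  rw [map_diffSum_volume]
  exact hg.smul_measure (by simp)

/-- The modulus of the diagonal trace at time `t` of the free evolution whose datum is `g` in
the variables `(x - y, x + y)`. -/
def diagTrace (g : ℝ × ℝ → ℂ) (t x : ℝ) : ℝ≥0∞ :=
  ENNReal.ofReal (1 / (8 * π * t)) * ‖∫ w : ℝ, cexp (I * (-x / (2 * t) : ℝ) * w) *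
    (cexp (I * (1 / (8 * t) : ℝ) * (w ^ 2 : ℝ)) * oscTrace g t w)‖ₑ

theorem enorm_freeLambda_diag (f : 𝓢(ℝ × ℝ, ℂ)) {t : ℝ} (ht : 0 < t) (x : ℝ) :
    ‖freeLambda (fun a b => f (a, b)) t x x‖ₑ = diagTrace (fun p => f (diffSum p)) t x := by
  let c : ℂ := -(1 / (4 * (I * t)))
  let G : ℝ × ℝ → ℂ := fun z => cexp (c * (((x - z.1) ^ 2 + (x - z.2) ^ 2 : ℝ) : ℂ)) * f z
  have hc : c = I * (1 / (4 * t) : ℝ) := by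
    simp only [c]; push_cast; field_simp; simp; ring
  have hG : Measurable G := (Continuous.measurable (by fun_prop)).mul f.continuous.measurable
  have hGi : Integrable G := by
    refine f.integrable.mono hG.aestronglyMeasurable (Filter.Eventually.of_forall fun z => ?_)
    simp only [G, norm_mul, hc, norm_cexp_I_mul_mul, one_mul, le_refl]
  have h1 : ∫ z, G z = 1 / 2 * ∫ p, G (diffSum p) := by
    rw [integral_comp_diffSum hG.stronglyMeasurable]; ring
  have h2 : ∫ p, G (diffSum p) = ∫ w : ℝ, cexp (I * (x ^ 2 / (2 * t) : ℝ)) *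
      (cexp (I * (-x / (2 * t) : ℝ) * w) *
        (cexp (I * (1 / (8 * t) : ℝ) * (w ^ 2 : ℝ)) *
          oscTrace (fun p => f (diffSum p)) t w)) := by
    rw [Measure.volume_eq_prod, integral_prod_symm _ (integrable_comp_diffSum hGi hG)]
    refine integral_congr_ae (Filter.Eventually.of_forall fun w => ?_)
    simp only [oscTrace]
    rw [← integral_const_mul, ← integral_const_mul, ← integral_const_mul]
    refine integral_congr_ae (Filter.Eventually.of_forall fun u => ?_)
    simp only [G, hc, ← mul_assoc, ← Complex.exp_add]
    congr 2
    rw [diffSum_apply]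
    push_cast
    field_simp
    ring
  rw [freeLambda_diag_eq f ht, diagTrace]
  change ‖((2 * (π : ℂ)) ^ 2)⁻¹ * (π / (I * t) * ∫ z, G z)‖ₑ = _
  rw [h1, h2, integral_const_mul, ← mul_assoc, ← mul_assoc, ← mul_assoc, enorm_mul]
  congr 1
  have hphase : ‖cexp (I * ((x ^ 2 / (2 * t) : ℝ) : ℂ))‖ = 1 := by
    rw [mul_comm, norm_exp_ofReal_mul_I]
  rw [← ofReal_norm, norm_mul _ (cexp _), hphase, mul_one]
  congr 1
  have hpi := Real.pi_pos
  simp [abs_of_pos ht, abs_of_pos hpi]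
  field_simp
  norm_num

theorem lintegral_comp_neg_div_two_mul {g : ℝ → ℝ≥0∞} (hg : Measurable g) {t : ℝ} (ht : 0 < t) :
    ∫⁻ x, g (-x / (2 * t)) = ENNReal.ofReal (2 * t) * ∫⁻ τ, g τ := by
  have e : ∀ x : ℝ, -x / (2 * t) = -(1 / (2 * t)) * x := by intro x; ring
  simp_rw [e]
  rw [← lintegral_map hg (measurable_const_mul _), Real.map_volume_mul_left
    (neg_ne_zero.2 (by positivity)), lintegral_smul_measure, smul_eq_mul]
  congr 2
  rw [inv_neg, abs_neg, one_div, inv_inv, abs_of_pos (by positivity)]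

theorem lintegral_diagTrace_sq_le {g : ℝ × ℝ → ℂ} (hg : Integrable g) (hgm : Measurable g)
    {t : ℝ} (ht : 0 < t) :
    ∫⁻ x, diagTrace g t x ^ 2 ≤ ENNReal.ofReal (1 / t) * ∫⁻ w, ‖oscTrace g t w‖ₑ ^ 2 := by
  let m : ℝ → ℂ := fun w => cexp (I * (1 / (8 * t) : ℝ) * (w ^ 2 : ℝ)) * oscTrace g t w
  have hQ : Measurable fun w => oscTrace g t w :=
    (measurable_oscTrace hgm).comp (f := fun w => (t, w)) (by fun_prop)
  have hmm : Measurable m := by simp only [m]; fun_prop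
  have hm : ∀ w, ‖m w‖ₑ = ‖oscTrace g t w‖ₑ := fun w => by
    rw [← ofReal_norm, norm_mul, norm_cexp_I_mul_mul, one_mul, ofReal_norm]
  have hQi : Integrable fun w => oscTrace g t w := by
    have : Integrable (fun p : ℝ × ℝ => cexp (I * (1 / (8 * t) : ℝ) * (p.1 ^ 2 : ℝ)) * g p)
        (volume.prod volume) := by
      refine hg.mono (Measurable.aestronglyMeasurable (by fun_prop))
        (Filter.Eventually.of_forall fun p => ?_)
      simp only [norm_mul, norm_cexp_I_mul_mul, one_mul, le_refl]
    exact this.integral_prod_right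
  have hmi : Integrable m := hQi.mono hmm.aestronglyMeasurable
    (Filter.Eventually.of_forall fun w => by
      simp only [m, norm_mul, norm_cexp_I_mul_mul, one_mul, le_refl])
  have hJ : Measurable fun τ : ℝ => ∫ w : ℝ, cexp (I * τ * w) * m w := by
    refine StronglyMeasurable.measurable ?_
    refine StronglyMeasurable.integral_prod_right (f := fun (τ w : ℝ) => cexp (I * τ * w) * m w)
      (Measurable.stronglyMeasurable ?_)
    simp only [Function.uncurry_def]
    fun_prop
  calc ∫⁻ x, diagTrace g t x ^ 2
      = ENNReal.ofReal (1 / (8 * π * t)) ^ 2 * ∫⁻ x, (fun τ : ℝ =>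
          ‖∫ w : ℝ, cexp (I * τ * w) * m w‖ₑ ^ 2) (-x / (2 * t)) := by
        refine Eq.trans (lintegral_congr fun x => ?_) (lintegral_const_mul _
          ((hJ.enorm.pow_const 2).comp (by fun_prop : Measurable fun x : ℝ => -x / (2 * t))))
        rw [diagTrace, mul_pow]
    _ = ENNReal.ofReal (1 / (8 * π * t)) ^ 2 * (ENNReal.ofReal (2 * t) *
          ∫⁻ τ : ℝ, ‖∫ w : ℝ, cexp (I * τ * w) * m w‖ₑ ^ 2) := by
        exact congrArg _ (lintegral_comp_neg_div_two_mul
          (g := fun τ : ℝ => ‖∫ w : ℝ, cexp (I * τ * w) * m w‖ₑ ^ 2) (hJ.enorm.pow_const 2) ht)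
    _ ≤ ENNReal.ofReal (1 / (8 * π * t)) ^ 2 * (ENNReal.ofReal (2 * t) *
          (ENNReal.ofReal (2 * π) * ∫⁻ w, ‖m w‖ₑ ^ 2)) := by
        gcongr
        exact lintegral_enorm_fourier_sq_le hmi hmm
    _ = ENNReal.ofReal ((1 / (8 * π * t)) ^ 2 * (2 * t) * (2 * π)) *
          ∫⁻ w, ‖oscTrace g t w‖ₑ ^ 2 := by
        simp_rw [hm]
        rw [← ENNReal.ofReal_pow (by positivity), ← mul_assoc, ← mul_assoc,
          ← ENNReal.ofReal_mul (by positivity), ← ENNReal.ofReal_mul (by positivity)]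
    _ ≤ _ := by
        gcongr
        rw [show (1 / (8 * π * t)) ^ 2 * (2 * t) * (2 * π) = 1 / (16 * π) * (1 / t) by
          field_simp; norm_num]
        refine mul_le_of_le_one_left (by positivity) ?_
        rw [div_le_one (by positivity)]
        linarith [Real.pi_gt_three]

end Rotation

section Splitting

theorem measurable_diagTrace_param {X : Type*} [MeasurableSpace X] {f : X → ℝ × ℝ → ℂ}
    (hf : Measurable (Function.uncurry f)) :
    Measurable fun p : X × ℝ × ℝ => diagTrace (f p.1) p.2.1 p.2.2 := by
  unfold diagTrace
  refine Measurable.mul (by fun_prop) (Measurable.enorm (StronglyMeasurable.measurable ?_))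
  refine StronglyMeasurable.integral_prod_right
    (f := fun (p : X × ℝ × ℝ) (w : ℝ) => cexp (I * (-p.2.2 / (2 * p.2.1) : ℝ) * w) *
      (cexp (I * (1 / (8 * p.2.1) : ℝ) * (w ^ 2 : ℝ)) * oscTrace (f p.1) p.2.1 w))
    (Measurable.stronglyMeasurable ?_)
  simp only [Function.uncurry_def]
  refine Measurable.mul (by fun_prop) (Measurable.mul (by fun_prop) ?_)
  exact (measurable_oscTrace_param hf).comp
    (f := fun q : (X × ℝ × ℝ) × ℝ => (q.1.1, (q.1.2.1, q.2))) (by fun_prop)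

/-- `‖oscTrace g t‖_{L²_w} ≤ ‖g‖_{L¹_u L²_w}`. -/
theorem lintegral_oscTrace_sq_le {g : ℝ × ℝ → ℂ} (hg : Measurable g) (t : ℝ) :
    ∫⁻ w, ‖oscTrace g t w‖ₑ ^ 2 ≤ (∫⁻ u, (∫⁻ w, ‖g (u, w)‖ₑ ^ 2) ^ (1 / 2 : ℝ)) ^ 2 := by
  refine le_trans (lintegral_mono fun w => ?_)
    (lintegral_lintegral_sq_le (a := fun u w => ‖g (u, w)‖ₑ) hg.enorm)
  refine pow_le_pow_left' ((enorm_integral_le_lintegral_enorm _).trans (le_of_eq ?_)) 2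
  refine lintegral_congr fun u => ?_
  rw [← ofReal_norm, norm_mul, norm_cexp_I_mul_mul, one_mul, ofReal_norm]

variable {α : Type*} [MeasurableSpace α] {μ : Measure α}

/-- The part of `f` above its `Lᵖ` norm is controlled in `L¹`. -/
theorem lintegral_indicator_lt_le {f : α → ℝ≥0∞} (hf : Measurable f) {p : ℝ} (hp : 1 < p)
    {l : ℝ≥0∞} (hl : l = (∫⁻ u, f u ^ p ∂μ) ^ (1 / p)) :
    ∫⁻ u, {u | l < f u}.indicator f u ∂μ ≤ l := by
  have hp0 : 0 < p := by linarith
  have hlp : l ^ p = ∫⁻ u, f u ^ p ∂μ := by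
    rw [hl, ← ENNReal.rpow_mul, one_div, inv_mul_cancel₀ hp0.ne', ENNReal.rpow_one]
  rcases eq_or_ne l ⊤ with h | htop
  · rw [h]; exact le_top
  rcases eq_or_ne l 0 with h | hzero
  · have h0 : ∫⁻ u, f u ^ p ∂μ = 0 := by rw [← hlp, h, ENNReal.zero_rpow_of_pos hp0]
    rw [lintegral_eq_zero_iff (hf.pow_const p)] at h0
    refine le_of_eq ?_
    rw [h, lintegral_eq_zero_iff (hf.indicator (measurableSet_lt measurable_const hf))]
    filter_upwards [h0] with u hu
    have : f u = 0 := by simpa [hp0, hp0.not_gt] using hu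
    simp [Set.indicator, this]
  have hc0 : l ^ (p - 1) ≠ 0 := by simp [hzero, htop]
  have hct : l ^ (p - 1) ≠ ⊤ := ENNReal.rpow_ne_top_of_nonneg (by linarith) htop
  refine (ENNReal.mul_le_mul_iff_right hc0 hct).1 ?_
  rw [← lintegral_const_mul _ (hf.indicator (measurableSet_lt measurable_const hf))]
  calc ∫⁻ u, l ^ (p - 1) * {u | l < f u}.indicator f u ∂μ ≤ ∫⁻ u, f u ^ p ∂μ := by
        refine lintegral_mono fun u => ?_
        by_cases hu : l < f u
        · simp only [Set.indicator, Set.mem_ofPred_eq, hu, if_true]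
          calc l ^ (p - 1) * f u ≤ f u ^ (p - 1) * f u ^ (1 : ℝ) := by
                rw [ENNReal.rpow_one]
                gcongr
            _ = f u ^ p := by
                rw [← ENNReal.rpow_add_of_nonneg _ _ (by linarith) zero_le_one, sub_add_cancel]
        · simp [Set.indicator, hu]
    _ = l ^ (p - 1) * l ^ (1 : ℝ) := by
        rw [← ENNReal.rpow_add_of_nonneg _ _ (by linarith) zero_le_one, sub_add_cancel, hlp]
    _ = _ := by rw [ENNReal.rpow_one]

/-- The part of `f` below its `Lᵖ` norm is controlled in `L²`. -/
theorem lintegral_indicator_le_sq_le {f : α → ℝ≥0∞} (hf : Measurable f) {p : ℝ} (hp : 1 < p)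
    (hp2 : p ≤ 2) {l : ℝ≥0∞} (hl : l = (∫⁻ u, f u ^ p ∂μ) ^ (1 / p)) :
    ∫⁻ u, {u | f u ≤ l}.indicator f u ^ 2 ∂μ ≤ l ^ 2 := by
  have hp0 : 0 < p := by linarith
  have hlp : l ^ p = ∫⁻ u, f u ^ p ∂μ := by
    rw [hl, ← ENNReal.rpow_mul, one_div, inv_mul_cancel₀ hp0.ne', ENNReal.rpow_one]
  have hsplit : ∀ a : ℝ≥0∞, a ^ 2 = a ^ (2 - p) * a ^ p := fun a => by
    rw [← ENNReal.rpow_add_of_nonneg _ _ (by linarith) hp0.le, sub_add_cancel, ENNReal.rpow_two]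
  calc ∫⁻ u, {u | f u ≤ l}.indicator f u ^ 2 ∂μ ≤ ∫⁻ u, l ^ (2 - p) * f u ^ p ∂μ := by
        refine lintegral_mono fun u => ?_
        by_cases hu : f u ≤ l
        · simp only [Set.indicator, Set.mem_ofPred_eq, hu, if_true]
          rw [hsplit]
          gcongr
        · simp [Set.indicator, hu]
    _ = l ^ 2 := by rw [lintegral_const_mul _ (hf.pow_const p), ← hlp, ← hsplit]

/-- Young's inequality `L^{4/3} * L² ⊂ L⁴` for nonnegative functions. -/
theorem lintegral_convolution_pow_four_le {k l : ℝ → ℝ≥0∞} (hk : Measurable k)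
    (hl : Measurable l) :
    ∫⁻ t, (∫⁻ s, k (t - s) ^ 3 * l s) ^ 4 ≤ (∫⁻ t, k t ^ 4) ^ 3 * (∫⁻ s, l s ^ 2) ^ 2 := by
  have hkt : ∀ t, Measurable fun s => k (t - s) := fun t => hk.comp (by fun_prop)
  have hk2 : Measurable (Function.uncurry fun t s : ℝ => k (t - s)) := hk.comp (by fun_prop)
  have h1 : ∀ t, (∫⁻ s, k (t - s) ^ 3 * l s) ^ 4 ≤
      (∫⁻ t, k t ^ 4) ^ 2 * ((∫⁻ s, l s ^ 2) * ∫⁻ s, k (t - s) ^ 4 * l s ^ 2) := by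
    intro t
    have ha := lintegral_mul_sq_le (μ := volume) ((hkt t).pow_const 2).aemeasurable
      ((hkt t).mul hl).aemeasurable
    have hb := lintegral_mul_sq_le (μ := volume) hl.aemeasurable
      (((hkt t).pow_const 2).mul hl).aemeasurable
    simp only [Pi.mul_apply] at ha hb
    have e : ∫⁻ s, (k (t - s) ^ 2) ^ 2 = ∫⁻ t, k t ^ 4 := by
      simp_rw [← pow_mul]
      exact lintegral_sub_left_eq_self (μ := volume) (fun s => k s ^ 4) t
    calc (∫⁻ s, k (t - s) ^ 3 * l s) ^ 4
        = ((∫⁻ s, k (t - s) ^ 2 * (k (t - s) * l s)) ^ 2) ^ 2 := by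
          rw [← pow_mul]
          congr 2
          ext s
          ring
      _ ≤ ((∫⁻ t, k t ^ 4) * ∫⁻ s, (k (t - s) * l s) ^ 2) ^ 2 := by
          rw [e] at ha
          exact pow_le_pow_left' ha 2
      _ = (∫⁻ t, k t ^ 4) ^ 2 * (∫⁻ s, l s * (k (t - s) ^ 2 * l s)) ^ 2 := by
          rw [mul_pow]
          congr 3
          ext s
          ring
      _ ≤ (∫⁻ t, k t ^ 4) ^ 2 * ((∫⁻ s, l s ^ 2) * ∫⁻ s, (k (t - s) ^ 2 * l s) ^ 2) := by
          gcongr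
      _ = _ := by
          congr 3
          ext s
          ring
  have hm : Measurable fun p : ℝ × ℝ => k (p.1 - p.2) ^ 4 * l p.2 ^ 2 :=
    (hk2.pow_const 4).mul ((hl.comp measurable_snd).pow_const 2)
  calc ∫⁻ t, (∫⁻ s, k (t - s) ^ 3 * l s) ^ 4
      ≤ ∫⁻ t, (∫⁻ t, k t ^ 4) ^ 2 * ((∫⁻ s, l s ^ 2) * ∫⁻ s, k (t - s) ^ 4 * l s ^ 2) :=
        lintegral_mono h1
    _ = (∫⁻ t, k t ^ 4) ^ 2 * ((∫⁻ s, l s ^ 2) * ∫⁻ t, ∫⁻ s, k (t - s) ^ 4 * l s ^ 2) := by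
        have : Measurable fun t => ∫⁻ s, k (t - s) ^ 4 * l s ^ 2 := hm.lintegral_prod_right'
        rw [lintegral_const_mul _ (this.const_mul _), lintegral_const_mul _ this]
    _ = (∫⁻ t, k t ^ 4) ^ 2 * ((∫⁻ s, l s ^ 2) * ∫⁻ s, (∫⁻ t, k t ^ 4) * l s ^ 2) := by
        rw [lintegral_lintegral_swap hm.aemeasurable]
        congr 3
        ext s
        rw [lintegral_mul_const _ (hk2.of_uncurry_right.pow_const 4),
          lintegral_sub_right_eq_self (μ := volume) (fun t => k t ^ 4) s]
    _ = _ := by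
        rw [lintegral_const_mul _ (hl.pow_const 2)]
        ring

end Splitting

section Time

theorem ENNReal.add_sq_le (a b : ℝ≥0∞) : (a + b) ^ 2 ≤ 2 * (a ^ 2 + b ^ 2) := by
  calc (a + b) ^ 2 = a ^ 2 + b ^ 2 + 2 * (a * b) := by ring
    _ ≤ a ^ 2 + b ^ 2 + (a ^ 2 + b ^ 2) := by
        gcongr
        exact ENNReal.two_mul_mul_le_sq_add_sq a b
    _ = _ := by ring

theorem ENNReal.add_pow_four_le (a b : ℝ≥0∞) : (a + b) ^ 4 ≤ 8 * (a ^ 4 + b ^ 4) := by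
  calc (a + b) ^ 4 = ((a + b) ^ 2) ^ 2 := by ring
    _ ≤ (2 * (a ^ 2 + b ^ 2)) ^ 2 := pow_le_pow_left' (ENNReal.add_sq_le a b) 2
    _ = 4 * (a ^ 2 + b ^ 2) ^ 2 := by ring
    _ ≤ 4 * (2 * ((a ^ 2) ^ 2 + (b ^ 2) ^ 2)) := by
        gcongr
        exact ENNReal.add_sq_le _ _
    _ = _ := by ring

/-- The `L²` triangle inequality with constant `2`. -/
theorem lintegral_add_sq_rpow_half_le {α : Type*} [MeasurableSpace α] {μ : Measure α}
    {f g : α → ℝ≥0∞} (hf : Measurable f) :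
    (∫⁻ x, (f x + g x) ^ 2 ∂μ) ^ (1 / 2 : ℝ) ≤
      2 * ((∫⁻ x, f x ^ 2 ∂μ) ^ (1 / 2 : ℝ) + (∫⁻ x, g x ^ 2 ∂μ) ^ (1 / 2 : ℝ)) := by
  calc (∫⁻ x, (f x + g x) ^ 2 ∂μ) ^ (1 / 2 : ℝ)
      ≤ (2 ^ 2 * ((∫⁻ x, f x ^ 2 ∂μ) + ∫⁻ x, g x ^ 2 ∂μ)) ^ (1 / 2 : ℝ) := by
        gcongr
        refine (lintegral_mono fun x => ENNReal.add_sq_le _ _).trans ?_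
        rw [lintegral_const_mul' _ _ (by simp), lintegral_add_left (hf.pow_const 2)]
        gcongr
        norm_num
    _ ≤ _ := by
        rw [ENNReal.mul_rpow_of_nonneg _ _ (by norm_num), ENNReal.sq_rpow_half]
        gcongr
        exact ENNReal.rpow_add_le_add_rpow _ _ (by norm_num) (by norm_num)

/-- The kernel `τ^{-1/6}` truncated to `(0, T)`. -/
def truncKernel (T τ : ℝ) : ℝ≥0∞ :=
  (Set.Ioo 0 T).indicator (fun τ => ENNReal.ofReal (τ ^ (-(1 / 6) : ℝ))) τ

theorem measurable_truncKernel (T : ℝ) : Measurable (truncKernel T) :=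
  Measurable.indicator (by fun_prop) measurableSet_Ioo

theorem truncKernel_pow_three {T τ : ℝ} (h : τ ∈ Set.Ioo 0 T) :
    truncKernel T τ ^ 3 = ENNReal.ofReal (τ ^ (-(1 / 2) : ℝ)) := by
  rw [truncKernel, Set.indicator_of_mem h, ← ENNReal.ofReal_pow (by have := h.1; positivity),
    ← Real.rpow_natCast, ← Real.rpow_mul h.1.le]
  norm_num

theorem lintegral_truncKernel_pow_four {T : ℝ} (hT : 0 < T) :
    ∫⁻ τ, truncKernel T τ ^ 4 = ENNReal.ofReal (3 * T ^ (1 / 3 : ℝ)) := by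
  have h1 : ∀ τ, truncKernel T τ ^ 4 =
      (Set.Ioo 0 T).indicator (fun τ => ENNReal.ofReal (τ ^ (-(2 / 3) : ℝ))) τ := by
    intro τ
    by_cases h : τ ∈ Set.Ioo 0 T
    · rw [truncKernel, Set.indicator_of_mem h, Set.indicator_of_mem h,
        ← ENNReal.ofReal_pow (by have := h.1; positivity),
        ← Real.rpow_natCast, ← Real.rpow_mul h.1.le]
      norm_num
    · simp [truncKernel, Set.indicator_of_notMem h]
  have hi : IntervalIntegrable (fun τ : ℝ => τ ^ (-(2 / 3) : ℝ)) volume 0 T :=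
    intervalIntegral.intervalIntegrable_rpow' (by norm_num)
  rw [intervalIntegrable_iff_integrableOn_Ioo_of_le hT.le] at hi
  simp_rw [h1]
  rw [lintegral_indicator measurableSet_Ioo, ← ofReal_integral_eq_lintegral_ofReal hi
    (ae_restrict_of_forall_mem measurableSet_Ioo fun τ hτ => Real.rpow_nonneg hτ.1.le _),
    ← integral_Ioc_eq_integral_Ioo, ← intervalIntegral.integral_of_le hT.le,
    integral_rpow (Or.inl (by norm_num))]
  congr 1
  norm_num
  ring

/-- Time integration of the Duhamel term from pointwise-in-`s` bounds. -/
theorem lintegral_duhamel_pow_four_le {A b : ℝ → ℝ → ℝ≥0∞} {l : ℝ → ℝ≥0∞} {D : ℝ≥0∞}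
    (hb : Measurable (Function.uncurry b)) (hl : Measurable l)
    (hA : ∀ s τ, 0 < τ → A s τ ≤ 2 * (ENNReal.ofReal (τ ^ (-(1 / 2) : ℝ)) * l s + b s τ))
    (hbl : ∀ s, ∫⁻ τ in Set.Ioi 0, b s τ ^ 4 ≤ D * l s ^ 4) {T : ℝ} (hT : 0 < T) (hT1 : T ≤ 1) :
    ∫⁻ t in Set.Ioc 0 T, (∫⁻ s in Set.Ioo 0 t, A s (t - s)) ^ 4 ≤
      128 * (27 + D) * ENNReal.ofReal T * (∫⁻ s, l s ^ 2) ^ 2 := by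
  let a : ℝ → ℝ → ℝ≥0∞ := fun s t => (Set.Ioi 0).indicator (b s) (t - s)
  have ha : Measurable (Function.uncurry a) := by
    have h1 : Measurable fun q : ℝ × ℝ => b q.1 (q.2 - q.1) :=
      hb.comp (f := fun q : ℝ × ℝ => (q.1, q.2 - q.1)) (by fun_prop)
    have h2 : MeasurableSet {q : ℝ × ℝ | 0 < q.2 - q.1} :=
      measurableSet_lt measurable_const (by fun_prop)
    exact h1.indicator h2
  have hk := measurable_truncKernel T
  let J₁ : ℝ → ℝ≥0∞ := fun t => ∫⁻ s, truncKernel T (t - s) ^ 3 * l s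
  let J₂ : ℝ → ℝ≥0∞ := fun t => ∫⁻ s in Set.Ioo 0 T, a s t
  have hJ₁m : Measurable J₁ := by
    refine Measurable.lintegral_prod_right'
      (f := fun q : ℝ × ℝ => truncKernel T (q.1 - q.2) ^ 3 * l q.2) ?_
    exact ((hk.comp (by fun_prop)).pow_const 3).mul (hl.comp measurable_snd)
  have hpt : ∀ t ∈ Set.Ioc 0 T, (∫⁻ s in Set.Ioo 0 t, A s (t - s)) ≤ 2 * (J₁ t + J₂ t) := by
    intro t ht
    calc ∫⁻ s in Set.Ioo 0 t, A s (t - s)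
        ≤ ∫⁻ s in Set.Ioo 0 t, 2 * (truncKernel T (t - s) ^ 3 * l s + a s t) := by
          refine setLIntegral_mono' measurableSet_Ioo fun s hs => ?_
          refine (hA s (t - s) (sub_pos.2 hs.2)).trans (le_of_eq ?_)
          rw [truncKernel_pow_three ⟨sub_pos.2 hs.2, by linarith [hs.1, ht.2]⟩]
          simp only [a]
          rw [Set.indicator_of_mem (Set.mem_Ioi.2 (sub_pos.2 hs.2))]
      _ = 2 * ((∫⁻ s in Set.Ioo 0 t, truncKernel T (t - s) ^ 3 * l s) +
            ∫⁻ s in Set.Ioo 0 t, a s t) := by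
          rw [lintegral_const_mul' _ _ (by simp), lintegral_add_left]
          exact ((hk.comp (by fun_prop : Measurable fun s : ℝ => t - s)).pow_const 3).mul hl
      _ ≤ _ := by
          refine mul_le_mul_right (add_le_add (setLIntegral_le_lintegral _ _) ?_) _
          exact lintegral_mono_set (Set.Ioo_subset_Ioo_right ht.2)
  have hJ₁ : ∫⁻ t, J₁ t ^ 4 ≤ 27 * ENNReal.ofReal T * (∫⁻ s, l s ^ 2) ^ 2 := by
    refine (lintegral_convolution_pow_four_le hk hl).trans (le_of_eq ?_)
    rw [lintegral_truncKernel_pow_four hT, ← ENNReal.ofReal_pow (by positivity), mul_pow,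
      ← Real.rpow_natCast, ← Real.rpow_natCast, ← Real.rpow_mul hT.le,
      ENNReal.ofReal_mul (by positivity)]
    norm_num
  have hJ₂ : ∫⁻ t, J₂ t ^ 4 ≤ D * ENNReal.ofReal T * (∫⁻ s, l s ^ 2) ^ 2 := by
    have hs : ∀ s, ∫⁻ t, a s t ^ 4 ≤ D * l s ^ 4 := by
      intro s
      refine le_trans (le_of_eq ?_) (hbl s)
      rw [← lintegral_indicator measurableSet_Ioi]
      refine Eq.trans (lintegral_congr fun t => ?_)
        (lintegral_sub_right_eq_self (μ := volume)
          ((Set.Ioi 0).indicator fun τ => b s τ ^ 4) s)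
      simp only [a]
      by_cases h : t - s ∈ Set.Ioi 0
      · rw [Set.indicator_of_mem h, Set.indicator_of_mem h]
      · rw [Set.indicator_of_notMem h, Set.indicator_of_notMem h]; norm_num
    have hcs : (∫⁻ s in Set.Ioo 0 T, l s) ^ 2 ≤ ENNReal.ofReal T * ∫⁻ s, l s ^ 2 := by
      have h := lintegral_mul_sq_le (μ := volume.restrict (Set.Ioo 0 T))
        (f := fun _ => 1) aemeasurable_const hl.aemeasurable
      simp only [one_mul, one_pow, lintegral_const, Measure.restrict_apply_univ,
        Real.volume_Ioo, sub_zero] at h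
      exact h.trans (mul_le_mul_right (setLIntegral_le_lintegral _ _) _)
    calc ∫⁻ t, J₂ t ^ 4
        ≤ (∫⁻ s in Set.Ioo 0 T, (∫⁻ t, a s t ^ 4) ^ (1 / 4 : ℝ)) ^ 4 :=
          lintegral_lintegral_pow_four_le ha
      _ ≤ (∫⁻ s in Set.Ioo 0 T, D ^ (1 / 4 : ℝ) * l s) ^ 4 := by
          refine pow_le_pow_left' (lintegral_mono fun s => ?_) 4
          refine (ENNReal.rpow_le_rpow (hs s) (by norm_num)).trans (le_of_eq ?_)
          rw [ENNReal.mul_rpow_of_nonneg _ _ (by norm_num), ENNReal.pow_four_rpow_quarter]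
      _ = D * ((∫⁻ s in Set.Ioo 0 T, l s) ^ 2) ^ 2 := by
          rw [lintegral_const_mul _ hl, mul_pow, ENNReal.rpow_quarter_pow_four, ← pow_mul]
      _ ≤ D * (ENNReal.ofReal T * ∫⁻ s, l s ^ 2) ^ 2 := by gcongr
      _ = D * (ENNReal.ofReal T * ENNReal.ofReal T) * (∫⁻ s, l s ^ 2) ^ 2 := by ring
      _ ≤ _ := by
          gcongr
          refine mul_le_of_le_one_right' ?_
          simpa using hT1
  calc ∫⁻ t in Set.Ioc 0 T, (∫⁻ s in Set.Ioo 0 t, A s (t - s)) ^ 4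
      ≤ ∫⁻ t in Set.Ioc 0 T, 128 * (J₁ t ^ 4 + J₂ t ^ 4) := by
        refine setLIntegral_mono' measurableSet_Ioc fun t ht => ?_
        refine (pow_le_pow_left' (hpt t ht) 4).trans ?_
        rw [mul_pow]
        refine (mul_le_mul_right (ENNReal.add_pow_four_le _ _) _).trans (le_of_eq ?_)
        ring
    _ ≤ ∫⁻ t, 128 * (J₁ t ^ 4 + J₂ t ^ 4) := setLIntegral_le_lintegral _ _
    _ = 128 * ((∫⁻ t, J₁ t ^ 4) + ∫⁻ t, J₂ t ^ 4) := by
        rw [lintegral_const_mul' _ _ (by simp), lintegral_add_left (hJ₁m.pow_const 4)]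
    _ ≤ 128 * (27 * ENNReal.ofReal T * (∫⁻ s, l s ^ 2) ^ 2 +
          D * ENNReal.ofReal T * (∫⁻ s, l s ^ 2) ^ 2) := by gcongr
    _ = _ := by ring

end Time

section Truncation

/-- The `L²` norm in `w` of the slice `g (u, ·)`. -/
def sliceNorm (g : ℝ × ℝ → ℂ) (u : ℝ) : ℝ≥0∞ := (∫⁻ w, ‖g (u, w)‖ₑ ^ 2) ^ (1 / 2 : ℝ)

/-- The `Lᵖ_u L²_w` norm of `g`. -/
def sliceLpNorm (p : ℝ) (g : ℝ × ℝ → ℂ) : ℝ≥0∞ := (∫⁻ u, sliceNorm g u ^ p) ^ (1 / p)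

/-- The part of `g` living on slices of norm at most `l`. -/
def lowPart (l : ℝ≥0∞) (g : ℝ × ℝ → ℂ) : ℝ × ℝ → ℂ := {q | sliceNorm g q.1 ≤ l}.indicator g

/-- The part of `g` living on slices of norm larger than `l`. -/
def highPart (l : ℝ≥0∞) (g : ℝ × ℝ → ℂ) : ℝ × ℝ → ℂ := {q | l < sliceNorm g q.1}.indicator g

theorem measurable_sliceNorm_param {X : Type*} [MeasurableSpace X] {f : X → ℝ × ℝ → ℂ}
    (hf : Measurable (Function.uncurry f)) :
    Measurable fun p : X × ℝ => sliceNorm (f p.1) p.2 := by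
  refine (Measurable.lintegral_prod_right'
    (f := fun z : (X × ℝ) × ℝ => ‖f z.1.1 (z.1.2, z.2)‖ₑ ^ 2) ?_).pow_const _
  exact (hf.comp (f := fun z : (X × ℝ) × ℝ => (z.1.1, (z.1.2, z.2)))
    (by fun_prop)).enorm.pow_const 2

theorem measurable_sliceLpNorm_param {X : Type*} [MeasurableSpace X] {f : X → ℝ × ℝ → ℂ}
    (hf : Measurable (Function.uncurry f)) (p : ℝ) :
    Measurable fun x => sliceLpNorm p (f x) :=
  (Measurable.lintegral_prod_right' (f := fun z : X × ℝ => sliceNorm (f z.1) z.2 ^ p)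
    ((measurable_sliceNorm_param hf).pow_const p)).pow_const _

theorem measurable_sliceNorm {g : ℝ × ℝ → ℂ} (hg : Measurable g) : Measurable (sliceNorm g) :=
  (measurable_sliceNorm_param (X := Unit) (f := fun _ => g) (hg.comp measurable_snd)).comp
    (f := fun u : ℝ => ((), u)) (by fun_prop)

theorem measurable_lowPart_param {X : Type*} [MeasurableSpace X] {f : X → ℝ × ℝ → ℂ}
    (hf : Measurable (Function.uncurry f)) {l : X → ℝ≥0∞} (hl : Measurable l) :
    Measurable (Function.uncurry fun x => lowPart (l x) (f x)) := by
  have h : MeasurableSet {z : X × ℝ × ℝ | sliceNorm (f z.1) z.2.1 ≤ l z.1} :=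
    measurableSet_le ((measurable_sliceNorm_param hf).comp
      (f := fun z : X × ℝ × ℝ => (z.1, z.2.1)) (by fun_prop)) (hl.comp measurable_fst)
  exact hf.indicator h

variable {g : ℝ × ℝ → ℂ}

theorem measurable_lowPart (hg : Measurable g) (l : ℝ≥0∞) : Measurable (lowPart l g) :=
  hg.indicator (measurableSet_le ((measurable_sliceNorm hg).comp measurable_fst) measurable_const)

theorem measurable_highPart (hg : Measurable g) (l : ℝ≥0∞) : Measurable (highPart l g) :=
  hg.indicator (measurableSet_lt measurable_const ((measurable_sliceNorm hg).comp measurable_fst))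

theorem highPart_add_lowPart (l : ℝ≥0∞) (q : ℝ × ℝ) : highPart l g q + lowPart l g q = g q := by
  by_cases h : l < sliceNorm g q.1
  · simp [highPart, lowPart, Set.indicator, h, h.not_ge]
  · simp [highPart, lowPart, Set.indicator, h, not_lt.1 h]

theorem sliceNorm_highPart (l : ℝ≥0∞) (u : ℝ) :
    sliceNorm (highPart l g) u = {u | l < sliceNorm g u}.indicator (sliceNorm g) u := by
  by_cases h : l < sliceNorm g u
  · rw [Set.indicator_of_mem (by simpa using h)]
    have : ∀ w, highPart l g (u, w) = g (u, w) :=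
      fun w => Set.indicator_of_mem (by simpa using h) _
    simp [sliceNorm, this]
  · rw [Set.indicator_of_notMem (by simpa using h)]
    have : ∀ w, highPart l g (u, w) = 0 := fun w => Set.indicator_of_notMem (by simpa using h) _
    simp [sliceNorm, this]

theorem lintegral_lowPart_sq (l : ℝ≥0∞) (u : ℝ) :
    ∫⁻ w, ‖lowPart l g (u, w)‖ₑ ^ 2 = {u | sliceNorm g u ≤ l}.indicator (sliceNorm g) u ^ 2 := by
  by_cases h : sliceNorm g u ≤ l
  · rw [Set.indicator_of_mem (by simpa using h), sliceNorm, ENNReal.rpow_half_sq]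
    have : ∀ w, lowPart l g (u, w) = g (u, w) :=
      fun w => Set.indicator_of_mem (by simpa using h) _
    simp [this]
  · rw [Set.indicator_of_notMem (by simpa using h)]
    have : ∀ w, lowPart l g (u, w) = 0 := fun w => Set.indicator_of_notMem (by simpa using h) _
    simp [this]

/-- The `L²` size at time `τ` of the trace generated by the low part of `g`. -/
def lowTrace (l : ℝ≥0∞) (g : ℝ × ℝ → ℂ) (τ : ℝ) : ℝ≥0∞ :=
  (ENNReal.ofReal (1 / τ) * ∫⁻ w, ‖oscTrace (lowPart l g) τ w‖ₑ ^ 2) ^ (1 / 2 : ℝ)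

theorem measurable_lowTrace_param {X : Type*} [MeasurableSpace X] {f : X → ℝ × ℝ → ℂ}
    (hf : Measurable (Function.uncurry f)) {l : X → ℝ≥0∞} (hl : Measurable l) :
    Measurable (Function.uncurry fun x τ => lowTrace (l x) (f x) τ) := by
  refine Measurable.pow_const (Measurable.mul (by fun_prop) ?_) _
  refine Measurable.lintegral_prod_right'
    (f := fun z : (X × ℝ) × ℝ => ‖oscTrace (lowPart (l z.1.1) (f z.1.1)) z.1.2 z.2‖ₑ ^ 2) ?_
  exact ((measurable_oscTrace_param (measurable_lowPart_param hf hl)).comp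
    (f := fun z : (X × ℝ) × ℝ => (z.1.1, (z.1.2, z.2))) (by fun_prop)).enorm.pow_const 2

theorem lintegral_lowTrace_pow_four_le (hg : Measurable g)
    (hgs : ∀ w, Integrable fun u => g (u, w)) {p : ℝ} (hp : 1 < p) (hp2 : p ≤ 2) :
    ∫⁻ τ in Set.Ioi 0, lowTrace (sliceLpNorm p g) g τ ^ 4 ≤
      ENNReal.ofReal (16 * π ^ 2) * sliceLpNorm p g ^ 4 := by
  set l := sliceLpNorm p g with hl
  have hm := measurable_lowPart hg l
  have hi : ∀ w, Integrable fun u => lowPart l g (u, w) := fun w =>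
    (hgs w).indicator (measurableSet_le (measurable_sliceNorm hg) measurable_const)
  calc ∫⁻ τ in Set.Ioi 0, lowTrace l g τ ^ 4
      = ∫⁻ τ in Set.Ioi (0 : ℝ), ENNReal.ofReal (1 / τ ^ 2) *
          (∫⁻ w, ‖oscTrace (lowPart l g) τ w‖ₑ ^ 2) ^ 2 := by
        refine setLIntegral_congr_fun measurableSet_Ioi fun τ hτ => ?_
        have hτ' : (0 : ℝ) < τ := hτ
        simp only [lowTrace]
        rw [show 4 = 2 * 2 from rfl, pow_mul, ENNReal.rpow_half_sq, mul_pow,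
          ← ENNReal.ofReal_pow (by positivity), div_pow, one_pow]
    _ ≤ ENNReal.ofReal (16 * π ^ 2) * (∫⁻ w, ∫⁻ u, ‖lowPart l g (u, w)‖ₑ ^ 2) ^ 2 :=
        lintegral_oscTrace_pow_four_le hm hi
    _ = ENNReal.ofReal (16 * π ^ 2) *
          (∫⁻ u, {u | sliceNorm g u ≤ l}.indicator (sliceNorm g) u ^ 2) ^ 2 := by
        rw [lintegral_lintegral_swap (f := fun w u => ‖lowPart l g (u, w)‖ₑ ^ 2)
          ((hm.comp measurable_swap).enorm.pow_const 2).aemeasurable]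
        simp_rw [lintegral_lowPart_sq]
    _ ≤ ENNReal.ofReal (16 * π ^ 2) * (l ^ 2) ^ 2 := by
        gcongr
        exact lintegral_indicator_le_sq_le (measurable_sliceNorm hg) hp hp2 hl
    _ = _ := by ring

theorem lintegral_diagTrace_sq_rpow_half_le (hg : Measurable g) (hgi : Integrable g)
    (hgs : ∀ w, Integrable fun u => g (u, w)) {p : ℝ} (hp : 1 < p) {τ : ℝ} (hτ : 0 < τ) :
    (∫⁻ x, diagTrace g τ x ^ 2) ^ (1 / 2 : ℝ) ≤
      2 * (ENNReal.ofReal (τ ^ (-(1 / 2) : ℝ)) * sliceLpNorm p g +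
        lowTrace (sliceLpNorm p g) g τ) := by
  set l := sliceLpNorm p g with hl
  have hsplit : ∀ w, oscTrace g τ w =
      oscTrace (highPart l g) τ w + oscTrace (lowPart l g) τ w := by
    intro w
    have hi : ∀ f : ℝ → ℂ, Integrable f →
        Integrable fun u => cexp (I * (1 / (8 * τ) : ℝ) * (u ^ 2 : ℝ)) * f u := by
      intro f hf
      refine hf.mono (AEStronglyMeasurable.mul (Continuous.aestronglyMeasurable (by fun_prop))
        hf.aestronglyMeasurable) (Filter.Eventually.of_forall fun u => ?_)
      simp only [norm_mul, norm_cexp_I_mul_mul, one_mul, le_refl]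
    simp only [oscTrace]
    rw [← integral_add
      (hi (fun u => highPart l g (u, w))
        ((hgs w).indicator (measurableSet_lt measurable_const (measurable_sliceNorm hg))))
      (hi (fun u => lowPart l g (u, w))
        ((hgs w).indicator (measurableSet_le (measurable_sliceNorm hg) measurable_const)))]
    simp_rw [← mul_add, highPart_add_lowPart]
  have hosc : ∀ {f : ℝ × ℝ → ℂ}, Measurable f → Measurable fun w => ‖oscTrace f τ w‖ₑ :=
    fun hf => ((measurable_oscTrace hf).comp (f := fun w : ℝ => (τ, w)) (by fun_prop)).enorm
  have hroot : ENNReal.ofReal (1 / τ) ^ (1 / 2 : ℝ) = ENNReal.ofReal (τ ^ (-(1 / 2) : ℝ)) := by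
    rw [ENNReal.ofReal_rpow_of_pos (by positivity), one_div, Real.inv_rpow hτ.le,
      Real.rpow_neg hτ.le]
  have hhigh : (∫⁻ w, ‖oscTrace (highPart l g) τ w‖ₑ ^ 2) ^ (1 / 2 : ℝ) ≤ l := by
    refine (ENNReal.rpow_le_rpow (lintegral_oscTrace_sq_le (measurable_highPart hg l) τ)
      (by norm_num)).trans ?_
    rw [ENNReal.sq_rpow_half]
    refine le_trans (le_of_eq (lintegral_congr fun u => sliceNorm_highPart l u)) ?_
    exact lintegral_indicator_lt_le (measurable_sliceNorm hg) hp hl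
  calc (∫⁻ x, diagTrace g τ x ^ 2) ^ (1 / 2 : ℝ)
      ≤ (ENNReal.ofReal (1 / τ) * ∫⁻ w, ‖oscTrace g τ w‖ₑ ^ 2) ^ (1 / 2 : ℝ) :=
        ENNReal.rpow_le_rpow (lintegral_diagTrace_sq_le hgi hg hτ) (by norm_num)
    _ = ENNReal.ofReal (1 / τ) ^ (1 / 2 : ℝ) *
          (∫⁻ w, ‖oscTrace g τ w‖ₑ ^ 2) ^ (1 / 2 : ℝ) :=
        ENNReal.mul_rpow_of_nonneg _ _ (by norm_num)
    _ ≤ ENNReal.ofReal (1 / τ) ^ (1 / 2 : ℝ) * (∫⁻ w, (‖oscTrace (highPart l g) τ w‖ₑ +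
          ‖oscTrace (lowPart l g) τ w‖ₑ) ^ 2) ^ (1 / 2 : ℝ) := by
        gcongr with w
        rw [hsplit]
        exact enorm_add_le _ _
    _ ≤ ENNReal.ofReal (1 / τ) ^ (1 / 2 : ℝ) *
          (2 * ((∫⁻ w, ‖oscTrace (highPart l g) τ w‖ₑ ^ 2) ^ (1 / 2 : ℝ) +
            (∫⁻ w, ‖oscTrace (lowPart l g) τ w‖ₑ ^ 2) ^ (1 / 2 : ℝ))) := by
        gcongr
        exact lintegral_add_sq_rpow_half_le (hosc (measurable_highPart hg l))
    _ ≤ ENNReal.ofReal (1 / τ) ^ (1 / 2 : ℝ) *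
          (2 * (l + (∫⁻ w, ‖oscTrace (lowPart l g) τ w‖ₑ ^ 2) ^ (1 / 2 : ℝ))) := by
        gcongr
    _ = _ := by
        rw [lowTrace, ENNReal.mul_rpow_of_nonneg _ _ (by norm_num : (0 : ℝ) ≤ 1 / 2), hroot]
        ring

end Truncation

section SchwartzSlices

/-- The section `F (s, ·)` of a Schwartz function. -/
def schwartzSection (F : 𝓢(ℝ × ℝ × ℝ, ℂ)) (s : ℝ) : 𝓢(ℝ × ℝ, ℂ) :=
  SchwartzMap.compCLM ℝ (g := fun z : ℝ × ℝ => ((s, (0 : ℝ × ℝ)) : ℝ × ℝ × ℝ) +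
      ContinuousLinearMap.inr ℝ ℝ (ℝ × ℝ) z)
    ((Function.HasTemperateGrowth.const _).add
      (ContinuousLinearMap.inr ℝ ℝ (ℝ × ℝ)).hasTemperateGrowth)
    ⟨1, 1, fun z => by
      have : ‖z‖ ≤ ‖((s, z) : ℝ × ℝ × ℝ)‖ := norm_snd_le ((s, z) : ℝ × ℝ × ℝ)
      simp only [ContinuousLinearMap.inr_apply, Prod.mk_add_mk, add_zero, zero_add, pow_one,
        one_mul]
      linarith⟩ F

theorem schwartzSection_apply (F : 𝓢(ℝ × ℝ × ℝ, ℂ)) (s : ℝ) (z : ℝ × ℝ) :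
    schwartzSection F s z = F (s, z) := by
  simp [schwartzSection]

theorem exists_norm_comp_diffSum_le (f : 𝓢(ℝ × ℝ, ℂ)) :
    ∃ C : ℝ, 0 ≤ C ∧ ∀ u w, ‖f (diffSum (u, w))‖ ≤ C * ((1 + u ^ 2)⁻¹ * (1 + w ^ 2)⁻¹) := by
  let M := 2 ^ 4 * (Finset.Iic ((4, 0) : ℕ × ℕ)).sup
    (fun m => SchwartzMap.seminorm ℝ m.1 m.2) f
  refine ⟨16 * M, by positivity, fun u w => ?_⟩
  have h := SchwartzMap.one_add_le_sup_seminorm_apply (𝕜 := ℝ) (m := (4, 0)) (k := 4) (n := 0)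
    le_rfl le_rfl f (diffSum (u, w))
  rw [norm_iteratedFDeriv_zero] at h
  set n := ‖diffSum (u, w)‖ with hn
  have hn0 : 0 ≤ n := norm_nonneg _
  have h1 : |(w + u) / 2| ≤ n := by
    rw [hn, diffSum_apply]; exact norm_fst_le (((w + u) / 2, (w - u) / 2) : ℝ × ℝ)
  have h2 : |(w - u) / 2| ≤ n := by
    rw [hn, diffSum_apply]; exact norm_snd_le (((w + u) / 2, (w - u) / 2) : ℝ × ℝ)
  rw [abs_le] at h1 h2
  have hu : 1 + u ^ 2 ≤ 4 * (1 + n) ^ 2 := by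
    have : u ^ 2 ≤ (2 * n) ^ 2 := sq_le_sq' (by linarith) (by linarith)
    nlinarith
  have hw : 1 + w ^ 2 ≤ 4 * (1 + n) ^ 2 := by
    have : w ^ 2 ≤ (2 * n) ^ 2 := sq_le_sq' (by linarith) (by linarith)
    nlinarith
  rw [← mul_inv, ← div_eq_mul_inv, le_div_iff₀ (by positivity)]
  calc ‖f (diffSum (u, w))‖ * ((1 + u ^ 2) * (1 + w ^ 2))
      ≤ ‖f (diffSum (u, w))‖ * ((4 * (1 + n) ^ 2) * (4 * (1 + n) ^ 2)) := by gcongr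
    _ = 16 * ((1 + n) ^ 4 * ‖f (diffSum (u, w))‖) := by ring
    _ ≤ 16 * M := by gcongr

theorem integrable_slice_comp_diffSum (f : 𝓢(ℝ × ℝ, ℂ)) (w : ℝ) :
    Integrable fun u => f (diffSum (u, w)) := by
  obtain ⟨C, -, hC⟩ := exists_norm_comp_diffSum_le f
  refine Integrable.mono' ((integrable_inv_one_add_sq.mul_const (1 + w ^ 2)⁻¹).const_mul C)
    (Measurable.aestronglyMeasurable ?_) (Filter.Eventually.of_forall fun u => hC u w)
  exact f.continuous.measurable.comp (measurable_diffSum.comp (by fun_prop))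

theorem lintegral_inv_one_add_sq_ne_top :
    ∫⁻ w : ℝ, ENNReal.ofReal ((1 + w ^ 2)⁻¹) ≠ ⊤ :=
  integrable_inv_one_add_sq.lintegral_lt_top.ne

theorem exists_sliceNorm_le (f : 𝓢(ℝ × ℝ, ℂ)) :
    ∃ K : ℝ≥0∞, K ≠ ⊤ ∧ ∀ u, sliceNorm (fun q => f (diffSum q)) u ≤
      K * ENNReal.ofReal ((1 + u ^ 2)⁻¹) := by
  obtain ⟨C, hC0, hC⟩ := exists_norm_comp_diffSum_le f
  refine ⟨ENNReal.ofReal C * (∫⁻ w : ℝ, ENNReal.ofReal ((1 + w ^ 2)⁻¹)) ^ (1 / 2 : ℝ),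
    ENNReal.mul_ne_top ENNReal.ofReal_ne_top
      (ENNReal.rpow_ne_top_of_nonneg (by norm_num) lintegral_inv_one_add_sq_ne_top), fun u => ?_⟩
  calc sliceNorm (fun q => f (diffSum q)) u
      ≤ (∫⁻ w, (ENNReal.ofReal C * ENNReal.ofReal ((1 + u ^ 2)⁻¹)) ^ 2 *
          ENNReal.ofReal ((1 + w ^ 2)⁻¹)) ^ (1 / 2 : ℝ) := by
        unfold sliceNorm
        gcongr with w
        rw [← ofReal_norm]
        calc ENNReal.ofReal ‖f (diffSum (u, w))‖ ^ 2
            ≤ ENNReal.ofReal (C * ((1 + u ^ 2)⁻¹ * (1 + w ^ 2)⁻¹)) ^ 2 := by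
              gcongr; exact hC u w
          _ = (ENNReal.ofReal C * ENNReal.ofReal ((1 + u ^ 2)⁻¹)) ^ 2 *
                ENNReal.ofReal ((1 + w ^ 2)⁻¹) ^ 2 := by
              rw [← mul_assoc, ENNReal.ofReal_mul (by positivity), ENNReal.ofReal_mul hC0, mul_pow]
          _ ≤ _ := by
              refine mul_le_mul_right (pow_le_of_le_one zero_le ?_ two_ne_zero) _
              rw [ENNReal.ofReal_le_one]
              exact inv_le_one_of_one_le₀ (by nlinarith)
    _ = _ := by
        rw [lintegral_const_mul _ (by fun_prop), ENNReal.mul_rpow_of_nonneg _ _ (by norm_num),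
          ENNReal.sq_rpow_half]
        ring

theorem sliceNorm_ne_top (f : 𝓢(ℝ × ℝ, ℂ)) (u : ℝ) :
    sliceNorm (fun q => f (diffSum q)) u ≠ ⊤ := by
  obtain ⟨K, hK, h⟩ := exists_sliceNorm_le f
  exact ne_top_of_le_ne_top (ENNReal.mul_ne_top hK ENNReal.ofReal_ne_top) (h u)

theorem sliceLpNorm_ne_top (f : 𝓢(ℝ × ℝ, ℂ)) {p : ℝ} (hp : 1 < p) :
    sliceLpNorm p (fun q => f (diffSum q)) ≠ ⊤ := by
  obtain ⟨K, hK, h⟩ := exists_sliceNorm_le f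
  have hp0 : 0 < p := by linarith
  refine ENNReal.rpow_ne_top_of_nonneg (by positivity) ?_
  refine ne_top_of_le_ne_top (ENNReal.mul_ne_top (ENNReal.rpow_ne_top_of_nonneg hp0.le hK)
    lintegral_inv_one_add_sq_ne_top) ?_
  rw [← lintegral_const_mul _ (by fun_prop)]
  refine lintegral_mono fun u => ?_
  refine (ENNReal.rpow_le_rpow (h u) hp0.le).trans ?_
  rw [ENNReal.mul_rpow_of_nonneg _ _ hp0.le]
  refine mul_le_mul_right ?_ _
  refine (ENNReal.rpow_le_rpow_of_exponent_ge ?_ hp.le).trans (le_of_eq (ENNReal.rpow_one _))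
  rw [ENNReal.ofReal_le_one]
  exact inv_le_one_of_one_le₀ (by nlinarith)

theorem eLpNorm_two_eq {α E : Type*} [MeasurableSpace α] {μ : Measure α} [NormedAddCommGroup E]
    (f : α → E) : eLpNorm f 2 μ = (∫⁻ x, ‖f x‖ₑ ^ 2 ∂μ) ^ (1 / 2 : ℝ) := by
  rw [eLpNorm_eq_lintegral_rpow_enorm_toReal two_ne_zero ENNReal.ofNat_ne_top]
  simp

theorem eLpNorm_four_eq {α E : Type*} [MeasurableSpace α] {μ : Measure α} [NormedAddCommGroup E]
    (f : α → E) : eLpNorm f 4 μ = (∫⁻ x, ‖f x‖ₑ ^ 4 ∂μ) ^ (1 / 4 : ℝ) := by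
  rw [eLpNorm_eq_lintegral_rpow_enorm_toReal four_ne_zero ENNReal.ofNat_ne_top]
  have h : ∀ a : ℝ≥0∞, a ^ (4 : ℝ) = a ^ 4 := fun a => mod_cast ENNReal.rpow_natCast a 4
  simp only [ENNReal.toReal_ofNat, h]

theorem mixedN3_eq (F : 𝓢(ℝ × ℝ × ℝ, ℂ)) {p : ℝ} (hp : 1 < p) :
    MixedN3 volume 2 (ENNReal.ofReal p) 2 (fun t u w => F (t, (w + u) / 2, (w - u) / 2)) =
      (∫⁻ s, sliceLpNorm p (fun q => F (s, diffSum q)) ^ 2) ^ (1 / 2 : ℝ) := by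
  have hp0 : 0 < p := by linarith
  have hinner : ∀ t u, eLpNorm (fun w => F (t, (w + u) / 2, (w - u) / 2)) 2 volume =
      sliceNorm (fun q => F (t, diffSum q)) u := by
    intro t u
    simp only [eLpNorm_two_eq, sliceNorm, diffSum_apply]
  have hslice : ∀ t u, sliceNorm (fun q => F (t, diffSum q)) u ≠ ⊤ := fun t u => by
    simpa only [schwartzSection_apply] using sliceNorm_ne_top (schwartzSection F t) u
  have hlp : ∀ t, sliceLpNorm p (fun q => F (t, diffSum q)) ≠ ⊤ := fun t => by
    simpa only [schwartzSection_apply] using sliceLpNorm_ne_top (schwartzSection F t) hp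
  have hmid : ∀ t, eLpNorm (fun u => (sliceNorm (fun q => F (t, diffSum q)) u).toReal)
      (ENNReal.ofReal p) volume = sliceLpNorm p (fun q => F (t, diffSum q)) := by
    intro t
    rw [eLpNorm_eq_lintegral_rpow_enorm_toReal (by simpa using hp0) ENNReal.ofReal_ne_top,
      ENNReal.toReal_ofReal hp0.le]
    simp only [Real.enorm_toReal (hslice t _), sliceLpNorm]
  simp only [MixedN3, hinner, hmid, eLpNorm_two_eq, Real.enorm_toReal (hlp _)]

end SchwartzSlices

section Assembly

theorem lintegral_homogeneous_pow_four_le (f : 𝓢(ℝ × ℝ, ℂ)) :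
    ∫⁻ t in Set.Ioi (0 : ℝ),
        ((∫⁻ x, diagTrace (fun q => f (diffSum q)) t x ^ 2) ^ (1 / 2 : ℝ)) ^ 4 ≤
      ENNReal.ofReal (64 * π ^ 2) * L2K (fun a b => f (a, b)) ^ 4 := by
  have hf := f.continuous.measurable
  have hg : Measurable fun q => f (diffSum q) := hf.comp measurable_diffSum
  calc ∫⁻ t in Set.Ioi (0 : ℝ),
        ((∫⁻ x, diagTrace (fun q => f (diffSum q)) t x ^ 2) ^ (1 / 2 : ℝ)) ^ 4
      ≤ ∫⁻ t in Set.Ioi (0 : ℝ), ENNReal.ofReal (1 / t ^ 2) *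
          (∫⁻ w, ‖oscTrace (fun q => f (diffSum q)) t w‖ₑ ^ 2) ^ 2 := by
        refine setLIntegral_mono' measurableSet_Ioi fun t ht => ?_
        have ht' : (0 : ℝ) < t := ht
        rw [show 4 = 2 * 2 from rfl, pow_mul, ENNReal.rpow_half_sq]
        refine (pow_le_pow_left' (lintegral_diagTrace_sq_le
          (integrable_comp_diffSum f.integrable hf) hg ht') 2).trans (le_of_eq ?_)
        rw [mul_pow, ← ENNReal.ofReal_pow (by positivity), div_pow, one_pow]
    _ ≤ ENNReal.ofReal (16 * π ^ 2) * (∫⁻ w, ∫⁻ u, ‖f (diffSum (u, w))‖ₑ ^ 2) ^ 2 :=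
        lintegral_oscTrace_pow_four_le hg (integrable_slice_comp_diffSum f)
    _ = ENNReal.ofReal (16 * π ^ 2) * (2 * ∫⁻ z, ‖f z‖ₑ ^ 2) ^ 2 := by
        rw [← lintegral_comp_diffSum (hf.enorm.pow_const 2), Measure.volume_eq_prod,
          lintegral_prod_symm _ (hg.enorm.pow_const 2).aemeasurable]
    _ = _ := by
        have h : L2K (fun a b => f (a, b)) ^ 4 = (∫⁻ z, ‖f z‖ₑ ^ 2) ^ 2 := by
          rw [L2K, eLpNorm_two_eq, show 4 = 2 * 2 from rfl, pow_mul, ENNReal.rpow_half_sq]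
        rw [h, mul_pow, ← mul_assoc, show (64 * π ^ 2) = 16 * π ^ 2 * 4 by ring,
          ENNReal.ofReal_mul (p := 16 * π ^ 2) (q := 4) (by positivity)]
        norm_num

theorem enorm_duhamelLambda_diag_le (f : 𝓢(ℝ × ℝ, ℂ)) (F : 𝓢(ℝ × ℝ × ℝ, ℂ)) {t : ℝ}
    (ht : 0 < t) (x : ℝ) :
    ‖duhamelLambda (fun a b => f (a, b)) (fun s a b => F (s, a, b)) t x x‖ₑ ≤
      diagTrace (fun q => f (diffSum q)) t x +
        ∫⁻ s in Set.Ioo 0 t, diagTrace (fun q => F (s, diffSum q)) (t - s) x := by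
  rw [duhamelLambda, ← enorm_freeLambda_diag f ht]
  refine (enorm_add_le _ _).trans (add_le_add le_rfl ?_)
  rw [enorm_mul, show ‖I‖ₑ = 1 by rw [← ofReal_norm]; simp, one_mul,
    intervalIntegral.integral_of_le ht.le, integral_Ioc_eq_integral_Ioo]
  refine (enorm_integral_le_lintegral_enorm _).trans (le_of_eq ?_)
  refine setLIntegral_congr_fun measurableSet_Ioo fun s hs => ?_
  simpa only [schwartzSection_apply] using
    enorm_freeLambda_diag (schwartzSection F s) (sub_pos.2 hs.2) x

theorem eLpNorm_duhamelLambda_diag_le (f : 𝓢(ℝ × ℝ, ℂ)) (F : 𝓢(ℝ × ℝ × ℝ, ℂ)) {t : ℝ}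
    (ht : 0 < t) :
    eLpNorm (fun x => duhamelLambda (fun a b => f (a, b)) (fun s a b => F (s, a, b)) t x x) 2
        volume ≤
      2 * ((∫⁻ x, diagTrace (fun q => f (diffSum q)) t x ^ 2) ^ (1 / 2 : ℝ) +
        ∫⁻ s in Set.Ioo 0 t,
          (∫⁻ x, diagTrace (fun q => F (s, diffSum q)) (t - s) x ^ 2) ^ (1 / 2 : ℝ)) := by
  have hf : Measurable (Function.uncurry fun (_ : Unit) q => f (diffSum q)) :=
    f.continuous.measurable.comp (measurable_diffSum.comp measurable_snd)
  have hF : Measurable (Function.uncurry fun (s : ℝ) q => F (s, diffSum q)) :=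
    F.continuous.measurable.comp
      (measurable_fst.prodMk (measurable_diffSum.comp measurable_snd))
  have hA : Measurable fun x => diagTrace (fun q => f (diffSum q)) t x :=
    (measurable_diagTrace_param hf).comp (f := fun x : ℝ => ((), (t, x))) (by fun_prop)
  have hB : Measurable (Function.uncurry fun s x =>
      diagTrace (fun q => F (s, diffSum q)) (t - s) x) :=
    (measurable_diagTrace_param hF).comp (f := fun z : ℝ × ℝ => (z.1, (t - z.1, z.2)))
      (by fun_prop)
  rw [eLpNorm_two_eq]
  refine (ENNReal.rpow_le_rpow (lintegral_mono fun x =>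
    pow_le_pow_left' (enorm_duhamelLambda_diag_le f F ht x) 2) (by norm_num)).trans ?_
  refine (lintegral_add_sq_rpow_half_le hA).trans ?_
  gcongr
  refine (ENNReal.rpow_le_rpow (lintegral_lintegral_sq_le hB) (by norm_num)).trans (le_of_eq ?_)
  rw [ENNReal.sq_rpow_half]

end Assembly

/-- Inhomogeneous trace estimate for the two-variable Schrödinger equation. -/
theorem inhomogeneous_trace_estimate_lambda :
    ∃ p₀ : ℝ, 1 < p₀ ∧ ∀ p : ℝ, 1 < p → p ≤ p₀ →
      ∃ c C : ℝ, 0 < c ∧ 0 < C ∧ ∀ T : ℝ, 0 < T → T ≤ 1 →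
        ∀ Λ₀ : 𝓢(ℝ × ℝ, ℂ), ∀ F : 𝓢(ℝ × ℝ × ℝ, ℂ),
          MixedN2 (volume.restrict (Set.Icc (0:ℝ) T)) 4 2
              (fun t x =>
                duhamelLambda (fun a b => Λ₀ (a, b)) (fun s a b => F (s, a, b)) t x x)
            ≤ ENNReal.ofReal C *
                (L2K (fun a b => Λ₀ (a, b)) +
                  ENNReal.ofReal (T ^ c) *
                    MixedN3 volume 2 (ENNReal.ofReal p) 2
                      (fun t u w => F (t, (w + u) / 2, (w - u) / 2))) := by
  refine ⟨2, one_lt_two, fun p hp hp2 => ⟨1 / 4, 100, by norm_num, by norm_num,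
    fun T hT hT1 Λ₀ F => ?_⟩⟩
  rw [mixedN3_eq F hp, MixedN2, eLpNorm_four_eq]
  let h : ℝ → ℝ × ℝ → ℂ := fun s q => F (s, diffSum q)
  let l : ℝ → ℝ≥0∞ := fun s => sliceLpNorm p (h s)
  let A : ℝ → ℝ → ℝ≥0∞ := fun s τ => (∫⁻ x, diagTrace (h s) τ x ^ 2) ^ (1 / 2 : ℝ)
  let A₀ : ℝ → ℝ≥0∞ := fun t =>
    (∫⁻ x, diagTrace (fun q => Λ₀ (diffSum q)) t x ^ 2) ^ (1 / 2 : ℝ)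
  set L := L2K fun a b => Λ₀ (a, b) with hL
  change _ ≤ _ * (L + _ * (∫⁻ s, l s ^ 2) ^ (1 / 2 : ℝ))
  have hh : Measurable (Function.uncurry h) :=
    F.continuous.measurable.comp
      (measurable_fst.prodMk (measurable_diffSum.comp measurable_snd))
  have hl : Measurable l := measurable_sliceLpNorm_param hh p
  have hhs : ∀ s, Measurable (h s) := fun s => hh.of_uncurry_left
  have hhi : ∀ s, Integrable (h s) := fun s => by
    simpa only [schwartzSection_apply] using integrable_comp_diffSum
      (schwartzSection F s).integrable (schwartzSection F s).continuous.measurable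
  have hhw : ∀ s w, Integrable fun u => h s (u, w) := fun s w => by
    simpa only [schwartzSection_apply] using integrable_slice_comp_diffSum (schwartzSection F s) w
  have hA₀ : Measurable A₀ := by
    have hm : Measurable (Function.uncurry fun (_ : Unit) q => Λ₀ (diffSum q)) :=
      Λ₀.continuous.measurable.comp (measurable_diffSum.comp measurable_snd)
    refine (Measurable.lintegral_prod_right' (f := fun z : ℝ × ℝ =>
      diagTrace (fun q => Λ₀ (diffSum q)) z.1 z.2 ^ 2) ?_).pow_const _
    exact ((measurable_diagTrace_param hm).comp (f := fun z : ℝ × ℝ => ((), z))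
      (by fun_prop)).pow_const 2
  have hpi : π ^ 2 ≤ 10 := by nlinarith [Real.pi_lt_d2, Real.pi_pos]
  have hhom : ∫⁻ t in Set.Ioc 0 T, A₀ t ^ 4 ≤ 640 * L ^ 4 := by
    refine (lintegral_mono_set Set.Ioc_subset_Ioi_self).trans
      ((lintegral_homogeneous_pow_four_le Λ₀).trans ?_)
    gcongr
    refine ENNReal.ofReal_le_of_le_toReal ?_
    norm_num
    linarith
  have hinh : ∫⁻ t in Set.Ioc 0 T, (∫⁻ s in Set.Ioo 0 t, A s (t - s)) ^ 4 ≤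
      128 * (27 + 160) * ENNReal.ofReal T * (∫⁻ s, l s ^ 2) ^ 2 := by
    refine lintegral_duhamel_pow_four_le
      (b := fun s τ => lowTrace (l s) (h s) τ) (measurable_lowTrace_param hh hl) hl
      (fun s τ hτ => lintegral_diagTrace_sq_rpow_half_le (hhs s) (hhi s) (hhw s) hp hτ)
      (fun s => (lintegral_lowTrace_pow_four_le (hhs s) (hhw s) hp hp2).trans ?_) hT hT1
    gcongr
    refine ENNReal.ofReal_le_of_le_toReal ?_
    norm_num
    linarith
  set B := ENNReal.ofReal (T ^ (1 / 4 : ℝ)) * (∫⁻ s, l s ^ 2) ^ (1 / 2 : ℝ) with hB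
  have hB4 : B ^ 4 = ENNReal.ofReal T * (∫⁻ s, l s ^ 2) ^ 2 := by
    rw [hB, mul_pow, ← ENNReal.ofReal_pow (by positivity), ← Real.rpow_natCast,
      ← Real.rpow_mul hT.le, show 4 = 2 * 2 from rfl, pow_mul, ENNReal.rpow_half_sq]
    norm_num
  have key : ∫⁻ t in Set.Icc 0 T, ‖(eLpNorm (fun x => duhamelLambda (fun a b => Λ₀ (a, b))
      (fun s a b => F (s, a, b)) t x x) 2 volume).toReal‖ₑ ^ 4 ≤ (100 * (L + B)) ^ 4 := by
    rw [← setLIntegral_congr (Ioc_ae_eq_Icc (μ := volume) (a := (0 : ℝ)) (b := T))]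
    calc _ ≤ ∫⁻ t in Set.Ioc 0 T, 128 *
            (A₀ t ^ 4 + (∫⁻ s in Set.Ioo 0 t, A s (t - s)) ^ 4) := by
          refine setLIntegral_mono' measurableSet_Ioc fun t ht => ?_
          rw [Real.enorm_of_nonneg ENNReal.toReal_nonneg]
          refine (pow_le_pow_left' (ENNReal.ofReal_toReal_le.trans
            (eLpNorm_duhamelLambda_diag_le Λ₀ F ht.1)) 4).trans ?_
          rw [mul_pow]
          refine (mul_le_mul_right (ENNReal.add_pow_four_le _ _) _).trans (le_of_eq ?_)
          simp only [A₀, A, h]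
          ring
      _ = 128 * ((∫⁻ t in Set.Ioc 0 T, A₀ t ^ 4) +
            ∫⁻ t in Set.Ioc 0 T, (∫⁻ s in Set.Ioo 0 t, A s (t - s)) ^ 4) := by
          rw [lintegral_const_mul' _ _ (by simp), lintegral_add_left (hA₀.pow_const 4)]
      _ ≤ 128 * (640 * L ^ 4 + 128 * (27 + 160) * B ^ 4) := by
          rw [hB4, ← mul_assoc]
          gcongr
      _ ≤ 128 * (780000 * L ^ 4 + 780000 * B ^ 4) := by
          gcongr <;> norm_num
      _ ≤ 100000000 * (L ^ 4 + B ^ 4) := by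
          rw [← mul_add, ← mul_assoc]
          gcongr
          norm_num
      _ ≤ 100000000 * (L + B) ^ 4 := by
          gcongr
          exact pow_add_pow_le zero_le zero_le four_ne_zero
      _ = _ := by ring
  refine (ENNReal.rpow_le_rpow key (by norm_num)).trans (le_of_eq ?_)
  rw [ENNReal.pow_four_rpow_quarter]
  norm_num

end
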